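/- arXiv:2308.16579 — 4 statements merged into one kernel-verified Lean document; each statement's English description precedes it below -/
import Mathlib

section
/- Let α ∈ (−1, 0). The function t ↦ (1 − t)^{−α−1} + (1 + t)^{−α−1} − 2t^{−α−1} is strictly increasing and continuous on (0, 1), tends to −∞ as t → 0⁺ and to a positive value as t → 1⁻, and hence has a unique root r_{α,0} ∈ (0, 1). Moreover, for every x ∈ (0, π) and every t ∈ (0, r_{α,0}), the function x ↦ Î_α(x, t) := C_{−α}(x(1 − t)) + C_{−α}(x(1 + t)) − 2C_{−α}(xt) is increasing in x on (0, π). -/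
open scoped Real Topology
open Set Filter

/-- The Clausen function `C_s(x) = Re (Li_s (e^{ix}))`, realized via the periodic
(cosine) zeta function, which is automatically `2π`-periodic and even in `x`. -/
noncomputable def Cl (s x : ℝ) : ℝ :=
  (HurwitzZeta.cosZeta (↑(x / (2 * π)) : UnitAddCircle) (s : ℂ)).re

/-- `Î_α(x, t) = C_{-α}(x(1-t)) + C_{-α}(x(1+t)) - 2 C_{-α}(xt)`. -/
noncomputable def Ihat (α x t : ℝ) : ℝ :=
  Cl (-α) (x * (1 - t)) + Cl (-α) (x * (1 + t)) - 2 * Cl (-α) (x * t)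

/-- The summand of the Dirichlet series of the even Hurwitz zeta function at `a ∈ [0, 1]`. -/
noncomputable def hurwitzEvenTerm (a : ℝ) (s : ℂ) (n : ℕ) : ℂ :=
  (((n + a : ℝ) : ℂ) ^ (-s) + ((n + 1 - a : ℝ) : ℂ) ^ (-s)) / 2

lemma norm_ofReal_cpow_neg_sub_le {m u v : ℝ} (hm : 0 < m) (hu : m ≤ u) (hv : m ≤ v) {s : ℂ}
    (hs : 0 < s.re) :
    ‖(u : ℂ) ^ (-s) - (v : ℂ) ^ (-s)‖ ≤ ‖s‖ * m ^ (-s.re - 1) * |u - v| := by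
  have hs0 : -s ≠ 0 := by
    rintro h
    simp [neg_eq_zero.mp h] at hs
  refine (convex_Ici m).norm_image_sub_le_of_norm_hasDerivWithin_le
    (f := fun y : ℝ => (y : ℂ) ^ (-s)) (f' := fun y : ℝ => -s * (y : ℂ) ^ (-s - 1))
    (fun y hy => (hasDerivAt_ofReal_cpow_const (hm.trans_le hy).ne' hs0).hasDerivWithinAt)
    (fun y hy => ?_) hv hu
  rw [norm_mul, norm_neg, Complex.norm_cpow_eq_rpow_re_of_pos (hm.trans_le hy)]
  simp only [Complex.sub_re, Complex.neg_re, Complex.one_re]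
  exact mul_le_mul_of_nonneg_left (Real.rpow_le_rpow_of_nonpos hm hy (by linarith))
    (norm_nonneg s)

lemma norm_hurwitzEvenTerm_succ_sub_le {a b : ℝ} (ha : a ∈ Ioo (0 : ℝ) 1)
    (hb : b ∈ Ioo (0 : ℝ) 1) {s : ℂ} (hs : 0 < s.re) (n : ℕ) :
    ‖hurwitzEvenTerm a s (n + 1) - hurwitzEvenTerm b s (n + 1)‖ ≤
      ‖s‖ * ((n + 1 : ℕ) : ℝ) ^ (-s.re - 1) := by
  obtain ⟨ha0, ha1⟩ := ha
  obtain ⟨hb0, hb1⟩ := hb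
  have hm : (0 : ℝ) < ((n + 1 : ℕ) : ℝ) := by positivity
  have h₁ := norm_ofReal_cpow_neg_sub_le hm (u := (n + 1 : ℕ) + a) (v := (n + 1 : ℕ) + b)
    (by linarith) (by linarith) hs
  have h₂ := norm_ofReal_cpow_neg_sub_le hm (u := (n + 1 : ℕ) + 1 - a)
    (v := (n + 1 : ℕ) + 1 - b) (by linarith) (by linarith) hs
  set B := ‖s‖ * ((n + 1 : ℕ) : ℝ) ^ (-s.re - 1)
  have hB : 0 ≤ B := by positivity
  have h₁' : |((n + 1 : ℕ) : ℝ) + a - ((n + 1 : ℕ) + b)| ≤ 1 := by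
    rw [abs_le]; constructor <;> linarith
  have h₂' : |((n + 1 : ℕ) : ℝ) + 1 - a - ((n + 1 : ℕ) + 1 - b)| ≤ 1 := by
    rw [abs_le]; constructor <;> linarith
  replace h₁ := h₁.trans (mul_le_of_le_one_right hB h₁')
  replace h₂ := h₂.trans (mul_le_of_le_one_right hB h₂')
  have h := (norm_add_le _ _).trans (add_le_add h₁ h₂)
  calc _ = ‖((((n + 1 : ℕ) + a : ℝ) : ℂ) ^ (-s) - (((n + 1 : ℕ) + b : ℝ) : ℂ) ^ (-s) +
        ((((n + 1 : ℕ) + 1 - a : ℝ) : ℂ) ^ (-s) - (((n + 1 : ℕ) + 1 - b : ℝ) : ℂ) ^ (-s))) / 2‖ := by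
        unfold hurwitzEvenTerm
        congr 1
        ring
    _ ≤ B := by
        rw [norm_div, Complex.norm_two]
        linarith

lemma differentiable_hurwitzEvenTerm {a : ℝ} (ha : a ∈ Ioo (0 : ℝ) 1) (n : ℕ) :
    Differentiable ℂ fun s => hurwitzEvenTerm a s n := by
  have h₁ : ((n + a : ℝ) : ℂ) ≠ 0 := by
    have : (0 : ℝ) < n + a := by linarith [ha.1, (Nat.cast_nonneg n : (0 : ℝ) ≤ n)]
    exact_mod_cast this.ne'
  have h₂ : ((n + 1 - a : ℝ) : ℂ) ≠ 0 := by
    have : (0 : ℝ) < n + 1 - a := by linarith [ha.2, (Nat.cast_nonneg n : (0 : ℝ) ≤ n)]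
    exact_mod_cast this.ne'
  exact ((differentiable_id.neg.const_cpow (.inl h₁)).add
    (differentiable_id.neg.const_cpow (.inl h₂))).div_const 2

lemma hasSum_hurwitzEvenTerm {a : ℝ} (ha : a ∈ Ioo (0 : ℝ) 1) {s : ℂ} (hs : 1 < s.re) :
    HasSum (hurwitzEvenTerm a s) (HurwitzZeta.hurwitzZetaEven a s) := by
  refine (HurwitzZeta.hasSum_nat_hurwitzZetaEven_of_mem_Icc (Ioo_subset_Icc_self ha) hs).congr_fun
    fun n => ?_
  simp [hurwitzEvenTerm, Complex.cpow_neg]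

lemma summable_const_mul_succ_rpow (c : ℝ) {δ : ℝ} (hδ : 0 < δ) :
    Summable fun n : ℕ => c * ((n + 1 : ℕ) : ℝ) ^ (-δ - 1) :=
  ((summable_nat_add_iff 1).mpr (Real.summable_nat_rpow.mpr (by linarith))).mul_left c

/-- The tail of the difference of two even Hurwitz zeta series is holomorphic on `0 < re s`. -/
lemma differentiableOn_tsum_hurwitzEvenTerm_sub {a b : ℝ} (ha : a ∈ Ioo (0 : ℝ) 1)
    (hb : b ∈ Ioo (0 : ℝ) 1) :
    DifferentiableOn ℂ
      (fun s => ∑' n : ℕ, (hurwitzEvenTerm a s (n + 1) - hurwitzEvenTerm b s (n + 1)))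
      {s | 0 < s.re} := by
  intro s₀ hs₀
  have hs₀ : 0 < s₀.re := hs₀
  have hopen : IsOpen ({s : ℂ | s₀.re / 2 < s.re} ∩ Metric.ball 0 (‖s₀‖ + 1)) :=
    (isOpen_lt continuous_const Complex.continuous_re).inter Metric.isOpen_ball
  have h := Complex.differentiableOn_tsum_of_summable_norm
    (F := fun (n : ℕ) s => hurwitzEvenTerm a s (n + 1) - hurwitzEvenTerm b s (n + 1))
    (summable_const_mul_succ_rpow (‖s₀‖ + 1) (half_pos hs₀))
    (fun n => ((differentiable_hurwitzEvenTerm ha _).sub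
      (differentiable_hurwitzEvenTerm hb _)).differentiableOn) hopen ?_
  · refine (h.differentiableAt (hopen.mem_nhds ⟨?_, ?_⟩)).differentiableWithinAt
    · exact half_lt_self hs₀
    · simp
  · rintro n s ⟨hs, hs'⟩
    have hs : s₀.re / 2 < s.re := hs
    refine (norm_hurwitzEvenTerm_succ_sub_le ha hb (by linarith) n).trans ?_
    rw [mem_ball_zero_iff] at hs'
    gcongr
    simp

/-- The difference of two even Hurwitz zeta functions is given by the termwise difference of their
Dirichlet series on the half plane `0 < re s`. -/
lemma hasSum_hurwitzEvenTerm_sub {a b : ℝ} (ha : a ∈ Ioo (0 : ℝ) 1) (hb : b ∈ Ioo (0 : ℝ) 1)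
    {s : ℂ} (hs : 0 < s.re) :
    HasSum (fun n => hurwitzEvenTerm a s n - hurwitzEvenTerm b s n)
      (HurwitzZeta.hurwitzZetaEven a s - HurwitzZeta.hurwitzZetaEven b s) := by
  have hopen : IsOpen {s : ℂ | 0 < s.re} := isOpen_lt continuous_const Complex.continuous_re
  have hsum : Summable fun n : ℕ => hurwitzEvenTerm a s (n + 1) - hurwitzEvenTerm b s (n + 1) :=
    .of_norm_bounded (summable_const_mul_succ_rpow ‖s‖ hs)
      (norm_hurwitzEvenTerm_succ_sub_le ha hb hs)
  have hF : AnalyticOnNhd ℂ (fun s => HurwitzZeta.hurwitzZetaEven a s -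
      HurwitzZeta.hurwitzZetaEven b s) {s | 0 < s.re} :=
    (HurwitzZeta.differentiable_hurwitzZetaEven_sub_hurwitzZetaEven a
      b).differentiableOn.analyticOnNhd hopen
  have hG : AnalyticOnNhd ℂ (fun s =>
      (∑' n : ℕ, (hurwitzEvenTerm a s (n + 1) - hurwitzEvenTerm b s (n + 1))) +
        (hurwitzEvenTerm a s 0 - hurwitzEvenTerm b s 0)) {s | 0 < s.re} :=
    ((differentiableOn_tsum_hurwitzEvenTerm_sub ha hb).add
      ((differentiable_hurwitzEvenTerm ha 0).sub
        (differentiable_hurwitzEvenTerm hb 0)).differentiableOn).analyticOnNhd hopen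
  have heq := hF.eqOn_of_preconnected_of_eventuallyEq hG
    (convex_halfSpace_re_gt 0).isPreconnected (z₀ := 2) (by simp) ?_ hs
  · have h := (hasSum_nat_add_iff (f := fun n => hurwitzEvenTerm a s n - hurwitzEvenTerm b s n)
      1).mp hsum.hasSum
    rw [Finset.sum_range_one] at h
    beta_reduce at heq
    rwa [heq]
  · filter_upwards [(isOpen_lt continuous_const Complex.continuous_re).mem_nhds
      (show (1 : ℝ) < (2 : ℂ).re by simp)] with z hz
    have h := (hasSum_hurwitzEvenTerm ha hz).sub (hasSum_hurwitzEvenTerm hb hz)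
    rw [← h.tsum_eq, h.summable.tsum_eq_zero_add, add_comm]

/-- The real summand of the even Hurwitz zeta series, without the factor `1 / 2`. -/
noncomputable def realEvenTerm (σ a : ℝ) (n : ℕ) : ℝ :=
  (n + a) ^ (-σ) + (n + 1 - a) ^ (-σ)

lemma hurwitzEvenTerm_ofReal {a : ℝ} (ha : a ∈ Ioo (0 : ℝ) 1) (σ : ℝ) (n : ℕ) :
    hurwitzEvenTerm a σ n = ((realEvenTerm σ a n / 2 : ℝ) : ℂ) := by
  have hn : (0 : ℝ) ≤ n := n.cast_nonneg
  rw [hurwitzEvenTerm, realEvenTerm, ← Complex.ofReal_neg,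
    ← Complex.ofReal_cpow (by linarith [ha.1]), ← Complex.ofReal_cpow (by linarith [ha.2])]
  push_cast
  rfl

lemma hasSum_realEvenTerm_sub {a b : ℝ} (ha : a ∈ Ioo (0 : ℝ) 1) (hb : b ∈ Ioo (0 : ℝ) 1)
    {σ : ℝ} (hσ : 0 < σ) :
    HasSum (fun n => realEvenTerm σ a n - realEvenTerm σ b n)
      (2 * ((HurwitzZeta.hurwitzZetaEven a σ).re - (HurwitzZeta.hurwitzZetaEven b σ).re)) := by
  have h := (Complex.hasSum_re (hasSum_hurwitzEvenTerm_sub ha hb (s := σ) (by simpa))).mul_left 2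
  simp only [hurwitzEvenTerm_ofReal ha, hurwitzEvenTerm_ofReal hb, ← Complex.ofReal_sub,
    Complex.ofReal_re, Complex.sub_re] at h
  exact h.congr_fun fun n => by ring

/-- The symmetric combination of dilates of `k` appearing in `Ihat`. -/
def dilateSum (k : ℝ → ℝ) (t x : ℝ) : ℝ := k (x * (1 - t)) + k (x * (1 + t)) - 2 * k (x * t)

lemma monotoneOn_dilateSum {k k' : ℝ → ℝ} {t : ℝ} (ht : t ∈ Ioo (0 : ℝ) 1)
    (hk : ∀ y ∈ Ioo (0 : ℝ) 1, HasDerivAt k (k' y) y) (hk' : MonotoneOn k' (Ioo 0 1))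
    (hk0 : ∀ y ∈ Ioo (0 : ℝ) 1, 0 ≤ k' y) :
    MonotoneOn (dilateSum k t) (Ioo 0 (1 / 2)) := by
  obtain ⟨ht0, ht1⟩ := ht
  have hmem : ∀ x ∈ Ioo (0 : ℝ) (1 / 2), x * (1 - t) ∈ Ioo (0 : ℝ) 1 ∧
      x * (1 + t) ∈ Ioo (0 : ℝ) 1 ∧ x * t ∈ Ioo (0 : ℝ) 1 := by
    rintro x ⟨hx0, hx1⟩
    refine ⟨⟨mul_pos hx0 (by linarith), by nlinarith⟩, ⟨by positivity, by nlinarith⟩,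
      ⟨by positivity, by nlinarith⟩⟩
  have hd : ∀ x ∈ Ioo (0 : ℝ) (1 / 2), HasDerivAt (dilateSum k t)
      (k' (x * (1 - t)) * (1 - t) + k' (x * (1 + t)) * (1 + t) - 2 * (k' (x * t) * t)) x := by
    intro x hx
    obtain ⟨h₁, h₂, h₃⟩ := hmem x hx
    exact (((hk _ h₁).comp x (hasDerivAt_mul_const _)).add
      ((hk _ h₂).comp x (hasDerivAt_mul_const _))).sub
      (((hk _ h₃).comp x (hasDerivAt_mul_const _)).const_mul 2)
  refine monotoneOn_of_deriv_nonneg (convex_Ioo _ _)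
    (fun x hx => (hd x hx).continuousAt.continuousWithinAt) ?_ ?_
  · rw [interior_Ioo]
    exact fun x hx => (hd x hx).differentiableAt.differentiableWithinAt
  · rw [interior_Ioo]
    intro x hx
    rw [(hd x hx).deriv]
    obtain ⟨h₁, h₂, h₃⟩ := hmem x hx
    have hle : k' (x * t) ≤ k' (x * (1 + t)) := hk' h₃ h₂ (by nlinarith [hx.1])
    nlinarith [mul_nonneg (hk0 _ h₁) (sub_nonneg.2 ht1.le), hk0 _ h₃, hk0 _ h₂]

lemma hasDerivAt_sub_rpow_neg {c y : ℝ} (h : 0 < c - y) (σ : ℝ) :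
    HasDerivAt (fun y => (c - y) ^ (-σ)) (σ * (c - y) ^ (-σ - 1)) y := by
  convert ((hasDerivAt_id' y).const_sub c).rpow_const (p := -σ) (.inl h.ne') using 1
  ring

lemma hasDerivAt_add_rpow_neg {c y : ℝ} (h : 0 < c + y) (σ : ℝ) :
    HasDerivAt (fun y => (c + y) ^ (-σ)) (-(σ * (c + y) ^ (-σ - 1))) y := by
  convert ((hasDerivAt_id' y).const_add c).rpow_const (p := -σ) (.inl h.ne') using 1
  ring

lemma monotoneOn_dilateSum_sub_rpow {σ c t : ℝ} (hσ : 0 < σ) (hc : 1 ≤ c)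
    (ht : t ∈ Ioo (0 : ℝ) 1) :
    MonotoneOn (dilateSum (fun y => (c - y) ^ (-σ)) t) (Ioo 0 (1 / 2)) := by
  refine monotoneOn_dilateSum ht
    (fun y hy => hasDerivAt_sub_rpow_neg (by linarith [hy.2]) σ) ?_ ?_
  · intro y hy z hz hyz
    exact mul_le_mul_of_nonneg_left (Real.rpow_le_rpow_of_nonpos (by linarith [hz.2])
      (by linarith) (by linarith)) hσ.le
  · intro y hy
    have : 0 < c - y := by linarith [hy.2]
    positivity

lemma monotoneOn_dilateSum_sub_rpow_add_rpow {σ c t : ℝ} (hσ : 0 < σ) (hc : 1 ≤ c)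
    (ht : t ∈ Ioo (0 : ℝ) 1) :
    MonotoneOn (dilateSum (fun y => (c - y) ^ (-σ) + (c + y) ^ (-σ)) t) (Ioo 0 (1 / 2)) := by
  refine monotoneOn_dilateSum ht
    (fun y hy => (hasDerivAt_sub_rpow_neg (by linarith [hy.2]) σ).add
      (hasDerivAt_add_rpow_neg (by linarith [hy.1]) σ)) ?_ ?_
  · intro y hy z hz hyz
    refine add_le_add (mul_le_mul_of_nonneg_left (Real.rpow_le_rpow_of_nonpos (by linarith [hz.2])
      (by linarith) (by linarith)) hσ.le) (neg_le_neg (mul_le_mul_of_nonneg_left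
      (Real.rpow_le_rpow_of_nonpos (by linarith [hy.1]) (by linarith) (by linarith)) hσ.le))
  · intro y hy
    have h : (c + y) ^ (-σ - 1) ≤ (c - y) ^ (-σ - 1) :=
      Real.rpow_le_rpow_of_nonpos (by linarith [hy.2]) (by linarith [hy.1]) (by linarith)
    linarith [mul_le_mul_of_nonneg_left h hσ.le]

/-- Partial sums of the even Hurwitz series, regrouped symmetrically around the singularity. -/
lemma sum_range_succ_realEvenTerm (σ y : ℝ) (N : ℕ) :
    ∑ n ∈ Finset.range (N + 1), realEvenTerm σ y n =
      y ^ (-σ) + ∑ n ∈ Finset.range N, (((n + 1 : ℕ) - y) ^ (-σ) + ((n + 1 : ℕ) + y) ^ (-σ)) +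
        ((N + 1 : ℕ) - y) ^ (-σ) := by
  induction N with
  | zero => simp [realEvenTerm]
  | succ N ih =>
    rw [Finset.sum_range_succ, ih, Finset.sum_range_succ _ N, realEvenTerm]
    push_cast
    ring

lemma monotoneOn_dilateSum_partial {σ t : ℝ} (hσ : 0 < σ) (ht : t ∈ Ioo (0 : ℝ) 1) (N : ℕ) :
    MonotoneOn (fun x => dilateSum (fun y => ∑ n ∈ Finset.range (N + 1), realEvenTerm σ y n) t x -
      dilateSum (fun y => y ^ (-σ)) t x) (Ioo 0 (1 / 2)) := by
  intro x hx z hz hxz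
  have hlast := monotoneOn_dilateSum_sub_rpow hσ (c := (N + 1 : ℕ)) (by simp) ht hx hz hxz
  have hsum := Finset.sum_le_sum fun n (_ : n ∈ Finset.range N) =>
    monotoneOn_dilateSum_sub_rpow_add_rpow hσ (c := (n + 1 : ℕ)) (by simp) ht hx hz hxz
  simp only [dilateSum, Finset.sum_sub_distrib, Finset.sum_add_distrib,
    ← Finset.mul_sum] at hsum hlast
  simp only [dilateSum, sum_range_succ_realEvenTerm, Finset.sum_add_distrib]
  linarith

/-- Removing the singular summand from the even Hurwitz zeta function leaves a monotone
combination of dilates. -/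
lemma monotoneOn_dilateSum_hurwitzZetaEven {σ t : ℝ} (hσ : 0 < σ) (ht : t ∈ Ioo (0 : ℝ) 1) :
    MonotoneOn (fun x => 2 * dilateSum (fun y => (HurwitzZeta.hurwitzZetaEven y σ).re) t x -
      dilateSum (fun y => y ^ (-σ)) t x) (Ioo 0 (1 / 2)) := by
  have hlim : ∀ x ∈ Ioo (0 : ℝ) (1 / 2), Tendsto (fun N : ℕ =>
      dilateSum (fun y => ∑ n ∈ Finset.range (N + 1), realEvenTerm σ y n) t x -
        dilateSum (fun y => y ^ (-σ)) t x) atTop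
      (𝓝 (2 * dilateSum (fun y => (HurwitzZeta.hurwitzZetaEven y σ).re) t x -
        dilateSum (fun y => y ^ (-σ)) t x)) := by
    rintro x ⟨hx0, hx1⟩
    obtain ⟨ht0, ht1⟩ := ht
    have h₁ : x * (1 - t) ∈ Ioo (0 : ℝ) 1 := ⟨mul_pos hx0 (by linarith), by nlinarith⟩
    have h₂ : x * (1 + t) ∈ Ioo (0 : ℝ) 1 := ⟨by positivity, by nlinarith⟩
    have h₃ : x * t ∈ Ioo (0 : ℝ) 1 := ⟨by positivity, by nlinarith⟩
    have h := (((hasSum_realEvenTerm_sub h₁ h₃ hσ).add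
      (hasSum_realEvenTerm_sub h₂ h₃ hσ)).tendsto_sum_nat.comp (tendsto_add_atTop_nat 1)).sub_const
        (dilateSum (fun y => y ^ (-σ)) t x)
    convert h using 2
    · simp only [dilateSum, Function.comp_apply, Finset.sum_add_distrib, Finset.sum_sub_distrib]
      ring
    · simp only [dilateSum]
      ring
  intro x hx z hz hxz
  exact le_of_tendsto_of_tendsto' (hlim x hx) (hlim z hz)
    fun N => monotoneOn_dilateSum_partial hσ ht N hx hz hxz

lemma strictMonoOn_dilateSum_hurwitzZetaEven {σ t : ℝ} (hσ : 0 < σ) (ht : t ∈ Ioo (0 : ℝ) 1)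
    (hneg : (1 - t) ^ (-σ) + (1 + t) ^ (-σ) - 2 * t ^ (-σ) < 0) :
    StrictMonoOn (dilateSum (fun y => (HurwitzZeta.hurwitzZetaEven y σ).re) t)
      (Ioo 0 (1 / 2)) := by
  have hpow : ∀ x : ℝ, 0 < x → dilateSum (fun y => y ^ (-σ)) t x =
      x ^ (-σ) * ((1 - t) ^ (-σ) + (1 + t) ^ (-σ) - 2 * t ^ (-σ)) := by
    intro x hx
    simp only [dilateSum]
    rw [Real.mul_rpow hx.le (by linarith [ht.2]), Real.mul_rpow hx.le (by linarith [ht.1]),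
      Real.mul_rpow hx.le ht.1.le]
    ring
  intro x hx z hz hxz
  have h := monotoneOn_dilateSum_hurwitzZetaEven hσ ht hx hz hxz.le
  simp only [hpow x hx.1, hpow z hz.1] at h
  have := mul_lt_mul_of_neg_right
    (Real.rpow_lt_rpow_of_neg hx.1 hxz (neg_lt_zero.mpr hσ)) hneg
  linarith

/-- The Clausen function is a positive multiple of an even Hurwitz zeta value. -/
lemma exists_Cl_eq_mul_hurwitzZetaEven {σ : ℝ} (hσ : σ ∈ Ioo (0 : ℝ) 1) :
    ∃ K : ℝ, 0 < K ∧ ∀ x : ℝ, Cl (1 - σ) x =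
      K * (HurwitzZeta.hurwitzZetaEven (↑(x / (2 * π)) : UnitAddCircle) σ).re := by
  refine ⟨2 * (2 * π) ^ (-σ) * Real.Gamma σ * Real.cos (π * σ / 2), ?_, fun x => ?_⟩
  · have h₁ := Real.Gamma_pos_of_pos hσ.1
    have h₂ : 0 < Real.cos (π * σ / 2) := Real.cos_pos_of_mem_Ioo
      ⟨by nlinarith [Real.pi_pos, hσ.1], by nlinarith [Real.pi_pos, hσ.2]⟩
    have h₃ := Real.pi_pos
    positivity
  · have hs : ∀ n : ℕ, (σ : ℂ) ≠ 1 - n := by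
      intro n h
      have h' : σ = 1 - n := by exact_mod_cast h
      rcases n with _ | n
      · simp at h'
        linarith [hσ.2]
      · push_cast at h'
        linarith [hσ.1, (n.cast_nonneg : (0 : ℝ) ≤ n)]
    have h := HurwitzZeta.cosZeta_one_sub (↑(x / (2 * π)) : UnitAddCircle) hs
    rw [Cl, Complex.ofReal_sub, Complex.ofReal_one, h, ← Complex.re_ofReal_mul]
    congr 2
    push_cast
    rw [Complex.ofReal_cpow (by positivity), Complex.Gamma_ofReal]
    push_cast
    rfl

lemma strictMonoOn_Ihat {α t : ℝ} (hα : α ∈ Ioo (-1 : ℝ) 0) (ht : t ∈ Ioo (0 : ℝ) 1)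
    (hneg : (1 - t) ^ (-α - 1) + (1 + t) ^ (-α - 1) - 2 * t ^ (-α - 1) < 0) :
    StrictMonoOn (fun x => Ihat α x t) (Ioo 0 π) := by
  obtain ⟨K, hK, hCl⟩ := exists_Cl_eq_mul_hurwitzZetaEven (σ := 1 + α)
    ⟨by linarith [hα.1], by linarith [hα.2]⟩
  rw [show 1 - (1 + α) = -α by ring] at hCl
  have hI : ∀ x, Ihat α x t = K * dilateSum
      (fun y => (HurwitzZeta.hurwitzZetaEven y ((1 + α : ℝ) : ℂ)).re) t (x / (2 * π)) := by
    intro x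
    simp only [Ihat, hCl, dilateSum, div_mul_eq_mul_div]
    ring
  have hmem : ∀ x ∈ Ioo (0 : ℝ) π, x / (2 * π) ∈ Ioo (0 : ℝ) (1 / 2) := by
    rintro x ⟨hx0, hx1⟩
    have := Real.pi_pos
    exact ⟨by positivity, by rw [div_lt_iff₀ (by positivity)]; linarith⟩
  intro x hx z hz hxz
  simp only [hI]
  refine mul_lt_mul_of_pos_left (strictMonoOn_dilateSum_hurwitzZetaEven (by linarith [hα.1]) ht ?_
    (hmem x hx) (hmem z hz) (div_lt_div_of_pos_right hxz Real.two_pi_pos)) hK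
  rwa [show -(1 + α) = -α - 1 by ring]

lemma hasDerivAt_profile {t : ℝ} (ht : t ∈ Ioo (0 : ℝ) 1) (σ : ℝ) :
    HasDerivAt (fun t : ℝ => (1 - t) ^ (-σ) + (1 + t) ^ (-σ) - 2 * t ^ (-σ))
      (σ * ((1 - t) ^ (-σ - 1) - (1 + t) ^ (-σ - 1) + 2 * t ^ (-σ - 1))) t := by
  refine (((hasDerivAt_sub_rpow_neg (sub_pos.2 ht.2) σ).add
    (hasDerivAt_add_rpow_neg (c := 1) (by linarith [ht.1]) σ)).sub
      ((Real.hasDerivAt_rpow_const (p := -σ) (.inl ht.1.ne')).const_mul 2)).congr_deriv ?_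
  ring

lemma strictMonoOn_profile {σ : ℝ} (hσ : 0 < σ) :
    StrictMonoOn (fun t : ℝ => (1 - t) ^ (-σ) + (1 + t) ^ (-σ) - 2 * t ^ (-σ)) (Ioo 0 1) := by
  refine strictMonoOn_of_deriv_pos (convex_Ioo 0 1)
    (fun t ht => (hasDerivAt_profile ht σ).continuousAt.continuousWithinAt) ?_
  rw [interior_Ioo]
  intro t ht
  rw [(hasDerivAt_profile ht σ).deriv]
  have h₁ : (1 + t) ^ (-σ - 1) ≤ (1 - t) ^ (-σ - 1) :=
    Real.rpow_le_rpow_of_nonpos (by linarith [ht.2]) (by linarith [ht.1]) (by linarith)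
  have h₂ : 0 < t ^ (-σ - 1) := Real.rpow_pos_of_pos ht.1 _
  exact mul_pos hσ (by linarith)

lemma tendsto_profile_zero {σ : ℝ} (hσ : 0 < σ) :
    Tendsto (fun t : ℝ => (1 - t) ^ (-σ) + (1 + t) ^ (-σ) - 2 * t ^ (-σ)) (𝓝[>] 0) atBot := by
  have h₁ : ContinuousAt (fun t : ℝ => (1 - t) ^ (-σ) + (1 + t) ^ (-σ)) 0 :=
    ((hasDerivAt_sub_rpow_neg (by norm_num) σ).add
      (hasDerivAt_add_rpow_neg (by norm_num) σ)).continuousAt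
  have h₂ := (tendsto_rpow_neg_nhdsGT_zero (neg_lt_zero.mpr hσ)).const_mul_atTop
    (two_pos (α := ℝ))
  simpa only [sub_eq_add_neg, Function.comp_def] using
    (h₁.tendsto.mono_left nhdsWithin_le_nhds).add_atBot (tendsto_neg_atTop_atBot.comp h₂)

lemma tendsto_profile_one {σ : ℝ} (hσ : 0 < σ) :
    Tendsto (fun t : ℝ => (1 - t) ^ (-σ) + (1 + t) ^ (-σ) - 2 * t ^ (-σ)) (𝓝[<] 1) atTop := by
  have h₁ : ContinuousAt (fun t : ℝ => (1 + t) ^ (-σ) - 2 * t ^ (-σ)) 1 :=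
    ((hasDerivAt_add_rpow_neg (by norm_num) σ).sub
      ((Real.hasDerivAt_rpow_const (p := -σ) (.inl one_ne_zero)).const_mul 2)).continuousAt
  have hsub : Tendsto (fun t : ℝ => 1 - t) (𝓝[<] 1) (𝓝[>] 0) := by
    refine tendsto_nhdsWithin_iff.mpr ⟨?_, ?_⟩
    · have : ContinuousAt (fun t : ℝ => 1 - t) 1 := by fun_prop
      simpa [ContinuousAt] using this.tendsto.mono_left (nhdsWithin_le_nhds (s := Iio 1))
    · filter_upwards [self_mem_nhdsWithin] with t ht using sub_pos.2 (mem_Iio.mp ht)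
  have h₂ := (tendsto_rpow_neg_nhdsGT_zero (neg_lt_zero.mpr hσ)).comp hsub
  simpa only [add_sub_assoc, Function.comp_def] using
    h₂.atTop_add (h₁.tendsto.mono_left nhdsWithin_le_nhds)

/-- The profile `t ↦ (1-t)^{-α-1} + (1+t)^{-α-1} - 2t^{-α-1}` is strictly increasing and
continuous on `(0,1)`, tends to `-∞` at `0⁺` and to `+∞` at `1⁻`, and has a unique root
`r_{α,0}` there; moreover `x ↦ Î_α(x,t)` is increasing on `(0,π)` for `t ∈ (0, r_{α,0})`. -/
theorem profile_root_and_monotonicity (α : ℝ) (hα : α ∈ Set.Ioo (-1 : ℝ) 0) :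
    StrictMonoOn (fun t : ℝ => (1 - t) ^ (-α - 1) + (1 + t) ^ (-α - 1) - 2 * t ^ (-α - 1))
      (Set.Ioo 0 1) ∧
    ContinuousOn (fun t : ℝ => (1 - t) ^ (-α - 1) + (1 + t) ^ (-α - 1) - 2 * t ^ (-α - 1))
      (Set.Ioo 0 1) ∧
    Tendsto (fun t : ℝ => (1 - t) ^ (-α - 1) + (1 + t) ^ (-α - 1) - 2 * t ^ (-α - 1))
      (𝓝[>] (0 : ℝ)) atBot ∧
    Tendsto (fun t : ℝ => (1 - t) ^ (-α - 1) + (1 + t) ^ (-α - 1) - 2 * t ^ (-α - 1))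
      (𝓝[<] (1 : ℝ)) atTop ∧
    ∃ r ∈ Set.Ioo (0 : ℝ) 1,
      ((1 - r) ^ (-α - 1) + (1 + r) ^ (-α - 1) - 2 * r ^ (-α - 1) = 0) ∧
      (∀ r' ∈ Set.Ioo (0 : ℝ) 1,
        (1 - r') ^ (-α - 1) + (1 + r') ^ (-α - 1) - 2 * r' ^ (-α - 1) = 0 → r' = r) ∧
      ∀ t ∈ Set.Ioo (0 : ℝ) r, StrictMonoOn (fun x : ℝ => Ihat α x t) (Set.Ioo 0 π) := by
  have hσ : 0 < 1 + α := by linarith [hα.1]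
  have hexp : -α - 1 = -(1 + α) := by ring
  have hmono := strictMonoOn_profile hσ
  have hcont : ContinuousOn (fun t : ℝ => (1 - t) ^ (-(1 + α)) + (1 + t) ^ (-(1 + α)) -
      2 * t ^ (-(1 + α))) (Ioo 0 1) :=
    fun t ht => (hasDerivAt_profile ht _).continuousAt.continuousWithinAt
  have hzero := tendsto_profile_zero hσ
  have hone := tendsto_profile_one hσ
  rw [← hexp] at hmono hcont hzero hone
  refine ⟨hmono, hcont, hzero, hone, ?_⟩
  obtain ⟨u, hu, hu'⟩ := ((hzero.eventually_lt_atBot 0).and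
    (Ioo_mem_nhdsGT one_pos)).exists
  obtain ⟨v, hv, hv'⟩ := ((hone.eventually_gt_atTop 0).and
    (Ioo_mem_nhdsLT one_pos)).exists
  obtain ⟨r, hr, hr0⟩ := isPreconnected_Ioo.intermediate_value hu' hv' hcont ⟨hu.le, hv.le⟩
  refine ⟨r, hr, hr0, fun r' hr' h0 => hmono.injOn hr' hr (h0.trans hr0.symm), fun t ht => ?_⟩
  have ht' : t ∈ Ioo (0 : ℝ) 1 := ⟨ht.1, ht.2.trans hr.2⟩
  exact strictMonoOn_Ihat hα ht' ((hmono ht' hr ht.2).trans_eq hr0)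
end

section
/- For every α ∈ (−1, 0) and every x ∈ (0, π), the function t ↦ Î_α(x, t) := C_{−α}(x(1 − t)) + C_{−α}(x(1 + t)) − 2C_{−α}(xt) is strictly increasing and continuous on (0, 1), with lim_{t→0⁺} Î_α(x, t) = −∞ and lim_{t→1⁻} Î_α(x, t) = +∞; hence it has a unique root r_{α,x} ∈ (0, 1). Moreover r_{α,x} is decreasing in x (if 0 < x₁ ≤ x₂ < π then r_{α,x₂} ≤ r_{α,x₁}) and satisfies 1/2 < r_{α,x} < r_{α,0}, where r_{α,0} is the unique root in (0,1) of t ↦ (1 − t)^{−α−1} + (1 + t)^{−α−1} − 2t^{−α−1}. -/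
open scoped Real Topology
open Set Filter

/-- The symmetric second difference of `u ↦ u ^ (-s)` at `n + 1` with step `a`. -/
noncomputable def hurwitzTerm (a : ℝ) (s : ℂ) (n : ℕ) : ℂ :=
  ((n + 1 + a : ℝ) : ℂ) ^ (-s) + ((n + 1 - a : ℝ) : ℂ) ^ (-s) - 2 * ((n + 1 : ℝ) : ℂ) ^ (-s)

/-- The real symmetric second difference of `u ↦ u ^ (-σ)` at `n + 1` with step `a`. -/
noncomputable def hurwitzTermReal (σ a : ℝ) (n : ℕ) : ℝ :=
  (n + 1 + a) ^ (-σ) + (n + 1 - a) ^ (-σ) - 2 * ((n : ℝ) + 1) ^ (-σ)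

lemma hurwitzTerm_ofReal {a : ℝ} (ha : |a| < 1) (σ : ℝ) (n : ℕ) :
    hurwitzTerm a σ n = (hurwitzTermReal σ a n : ℂ) := by
  obtain ⟨h1, h2⟩ := abs_lt.1 ha
  have hn : (0 : ℝ) ≤ n := n.cast_nonneg
  unfold hurwitzTerm hurwitzTermReal
  push_cast [Complex.ofReal_cpow (show (0 : ℝ) ≤ n + 1 + a by linarith),
    Complex.ofReal_cpow (show (0 : ℝ) ≤ n + 1 - a by linarith),
    Complex.ofReal_cpow (show (0 : ℝ) ≤ n + 1 by linarith)]
  rfl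

lemma norm_cpow_shift_sub_le {a ρ R : ℝ} (ha : |a| < 1) {s : ℂ} (hρ : 0 < ρ) (hs : ρ ≤ s.re)
    (hR : ‖s‖ ≤ R) (n : ℕ) :
    ‖((n + 1 + a : ℝ) : ℂ) ^ (-s) - ((n + 1 : ℝ) : ℂ) ^ (-s)‖ ≤
      R * (1 - |a|) ^ (-R - 1) * ((n : ℝ) + 1) ^ (-ρ - 1) := by
  have hn : (0 : ℝ) ≤ n := n.cast_nonneg
  have ha0 := abs_nonneg a
  have hsR : s.re ≤ R := (Complex.re_le_norm s).trans hR
  have hpos : 0 < (1 - |a|) * ((n : ℝ) + 1) := by apply mul_pos <;> linarith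
  have hs0 : s ≠ 0 := by
    rintro rfl
    simp at hs
    linarith
  have key := (convex_Ici ((1 - |a|) * ((n : ℝ) + 1))).norm_image_sub_le_of_norm_hasDerivWithin_le
    (f := fun u : ℝ ↦ (u : ℂ) ^ (-s)) (f' := fun u : ℝ ↦ -s * (u : ℂ) ^ (-s - 1))
    (C := R * (1 - |a|) ^ (-R - 1) * ((n : ℝ) + 1) ^ (-ρ - 1)) (x := n + 1) (y := n + 1 + a)
    ?_ ?_ ?_ ?_
  · refine key.trans (mul_le_of_le_one_right ?_ ?_)
    · have : 0 ≤ R := (norm_nonneg s).trans hR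
      have : 0 ≤ 1 - |a| := by linarith
      positivity
    · simpa using ha.le
  · intro u hu
    have hu0 : 0 < u := hpos.trans_le hu
    refine HasDerivAt.hasDerivWithinAt ?_
    exact hasDerivAt_ofReal_cpow_const hu0.ne' (neg_ne_zero.2 hs0)
  · intro u hu
    have hu0 : 0 < u := hpos.trans_le hu
    rw [norm_mul, norm_neg, Complex.norm_cpow_eq_rpow_re_of_pos hu0, mul_assoc]
    refine mul_le_mul hR ?_ (by positivity) ((norm_nonneg s).trans hR)
    have hre : (-s - 1).re = -s.re - 1 := by simp
    rw [hre]
    calc u ^ (-s.re - 1) ≤ ((1 - |a|) * ((n : ℝ) + 1)) ^ (-s.re - 1) :=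
          Real.rpow_le_rpow_of_nonpos hpos hu (by linarith)
      _ = (1 - |a|) ^ (-s.re - 1) * ((n : ℝ) + 1) ^ (-s.re - 1) :=
          Real.mul_rpow (by linarith) (by linarith)
      _ ≤ (1 - |a|) ^ (-R - 1) * ((n : ℝ) + 1) ^ (-ρ - 1) := by
          refine mul_le_mul ?_ ?_ (by positivity) (Real.rpow_nonneg (by linarith) _)
          · exact Real.rpow_le_rpow_of_exponent_ge (by linarith) (by linarith) (by linarith)
          · exact Real.rpow_le_rpow_of_exponent_le (by linarith) (by linarith)
  · show (1 - |a|) * ((n : ℝ) + 1) ≤ n + 1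
    nlinarith
  · show (1 - |a|) * ((n : ℝ) + 1) ≤ n + 1 + a
    nlinarith [neg_abs_le a, mul_nonneg ha0 hn]

lemma norm_hurwitzTerm_le {a ρ R : ℝ} (ha : |a| < 1) {s : ℂ} (hρ : 0 < ρ) (hs : ρ ≤ s.re)
    (hR : ‖s‖ ≤ R) (n : ℕ) :
    ‖hurwitzTerm a s n‖ ≤ 2 * (R * (1 - |a|) ^ (-R - 1)) * ((n : ℝ) + 1) ^ (-ρ - 1) := by
  have h1 := norm_cpow_shift_sub_le ha hρ hs hR n
  have h2 := norm_cpow_shift_sub_le (a := -a) (by simpa using ha) hρ hs hR n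
  rw [abs_neg, ← sub_eq_add_neg] at h2
  have h3 : hurwitzTerm a s n =
      (((n + 1 + a : ℝ) : ℂ) ^ (-s) - ((n + 1 : ℝ) : ℂ) ^ (-s)) +
      (((n + 1 - a : ℝ) : ℂ) ^ (-s) - ((n + 1 : ℝ) : ℂ) ^ (-s)) := by
    unfold hurwitzTerm; ring
  rw [h3]
  refine (norm_add_le _ _).trans ?_
  linarith

lemma summable_nat_add_one_rpow {ρ : ℝ} (hρ : 0 < ρ) :
    Summable fun n : ℕ ↦ ((n : ℝ) + 1) ^ (-ρ - 1) := by
  have := (summable_nat_add_iff 1).2 (Real.summable_nat_rpow.2 (show -ρ - 1 < -1 by linarith))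
  simpa using this

lemma summable_hurwitzTermReal {a σ : ℝ} (ha : |a| < 1) (hσ : 0 < σ) :
    Summable (hurwitzTermReal σ a) := by
  refine Summable.of_norm_bounded ((summable_nat_add_one_rpow hσ).mul_left
    (2 * (σ * (1 - |a|) ^ (-σ - 1)))) fun n ↦ ?_
  have := norm_hurwitzTerm_le (s := (σ : ℂ)) (R := σ) ha hσ (by simp) (by simp [abs_of_pos hσ]) n
  rwa [hurwitzTerm_ofReal ha, Complex.norm_real] at this

lemma hasSum_shifted_cpow {a : ℝ} (ha : |a| < 1) {s : ℂ} (hs : 1 < s.re) :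
    HasSum (fun n : ℕ ↦ ((n + 1 + a : ℝ) : ℂ) ^ (-s) + ((n + 1 - a : ℝ) : ℂ) ^ (-s))
      (2 * HurwitzZeta.hurwitzZetaEven a s - ((|a| : ℝ) : ℂ) ^ (-s)) := by
  obtain ⟨h1, h2⟩ := abs_lt.1 ha
  have h := (HurwitzZeta.hasSum_int_hurwitzZetaEven a hs).nat_add_neg
  have h' := ((hasSum_nat_add_iff' 1).2 h).mul_left 2
  have hval : 2 * HurwitzZeta.hurwitzZetaEven a s - ((|a| : ℝ) : ℂ) ^ (-s) =
      2 * (HurwitzZeta.hurwitzZetaEven a s + 1 / (↑|((0 : ℤ) : ℝ) + a| : ℂ) ^ s / 2 -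
        ∑ i ∈ Finset.range 1, (1 / (↑|(((i : ℕ) : ℤ) : ℝ) + a| : ℂ) ^ s / 2 +
          1 / (↑|((-((i : ℕ) : ℤ) : ℤ) : ℝ) + a| : ℂ) ^ s / 2)) := by
    simp [Complex.cpow_neg]
    ring
  rw [hval]
  refine h'.congr_fun fun n ↦ ?_
  have hn : (0 : ℝ) ≤ n := n.cast_nonneg
  have e1 : |((((n + 1 : ℕ) : ℤ) : ℝ)) + a| = n + 1 + a := by
    push_cast; exact abs_of_nonneg (by linarith)
  have e2 : |(((-((n + 1 : ℕ) : ℤ) : ℤ) : ℝ)) + a| = n + 1 - a := by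
    push_cast; rw [abs_of_nonpos (by linarith)]; ring
  rw [e1, e2, Complex.cpow_neg, Complex.cpow_neg]
  ring

lemma hasSum_hurwitzTerm {a : ℝ} (ha : a ∈ Ioo (0 : ℝ) 1) {s : ℂ} (hs : 1 < s.re) :
    HasSum (hurwitzTerm a s) (2 * (HurwitzZeta.hurwitzZetaEven a s -
      HurwitzZeta.hurwitzZetaEven 0 s) - (a : ℂ) ^ (-s)) := by
  have h1 := hasSum_shifted_cpow (abs_lt.2 ⟨by linarith [ha.1], ha.2⟩) hs
  have h0 := hasSum_shifted_cpow (a := 0) (by simp) hs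
  have hs0 : s ≠ 0 := by
    rintro rfl
    simp at hs
    linarith
  have hval : 2 * (HurwitzZeta.hurwitzZetaEven a s - HurwitzZeta.hurwitzZetaEven 0 s) -
      (a : ℂ) ^ (-s) = 2 * HurwitzZeta.hurwitzZetaEven a s - ((|a| : ℝ) : ℂ) ^ (-s) -
        (2 * HurwitzZeta.hurwitzZetaEven ((0 : ℝ) : UnitAddCircle) s -
          ((|(0 : ℝ)| : ℝ) : ℂ) ^ (-s)) := by
    simp [abs_of_pos ha.1, Complex.zero_cpow (neg_ne_zero.2 hs0)]
    ring
  rw [hval]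
  refine (h1.sub h0).congr_fun fun n ↦ ?_
  simp only [hurwitzTerm, add_zero, sub_zero]
  ring

lemma hurwitzZetaEven_sub_eq_tsum {a : ℝ} (ha : a ∈ Ioo (0 : ℝ) 1) {s : ℂ} (hs : 0 < s.re) :
    2 * (HurwitzZeta.hurwitzZetaEven a s - HurwitzZeta.hurwitzZetaEven 0 s) =
      (a : ℂ) ^ (-s) + ∑' n, hurwitzTerm a s n := by
  have ha' : |a| < 1 := abs_lt.2 ⟨by linarith [ha.1], ha.2⟩
  set ρ := s.re / 2 with hρ
  set R := ‖s‖ + 3 with hR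
  have hρ0 : 0 < ρ := by positivity
  set U : Set ℂ := {z | ρ < z.re} ∩ Metric.ball 0 R with hU
  have hUo : IsOpen U := (isOpen_lt continuous_const Complex.continuous_re).inter Metric.isOpen_ball
  have hUc : IsPreconnected U :=
    ((convex_halfSpace_re_gt ρ).inter (convex_ball 0 R)).isPreconnected
  have hsU : s ∈ U := ⟨by show ρ < s.re; linarith, by simp [hR]⟩
  have hsR : s.re ≤ ‖s‖ := Complex.re_le_norm s
  have h2U : ((s.re + 2 : ℝ) : ℂ) ∈ U := by
    refine ⟨?_, ?_⟩
    · show ρ < (((s.re + 2 : ℝ) : ℂ)).re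
      rw [Complex.ofReal_re]; linarith
    · rw [mem_ball_zero_iff, Complex.norm_real, Real.norm_eq_abs, abs_of_pos (by linarith)]
      linarith
  have hterm : ∀ n, DifferentiableOn ℂ (fun z ↦ hurwitzTerm a z n) U := by
    intro n
    have hn : (0 : ℝ) ≤ n := n.cast_nonneg
    have aux : ∀ u : ℝ, 0 < u → Differentiable ℂ fun z : ℂ ↦ (u : ℂ) ^ (-z) := fun u hu z ↦
      differentiableAt_id.neg.const_cpow (Or.inl (by exact_mod_cast hu.ne'))
    exact (((aux _ (by linarith [ha.1])).add (aux _ (by linarith [ha.2]))).sub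
      ((aux _ (by linarith)).const_mul 2)).differentiableOn
  have hg : DifferentiableOn ℂ (fun z ↦ (a : ℂ) ^ (-z) + ∑' n, hurwitzTerm a z n) U := by
    refine DifferentiableOn.add ?_ ?_
    · exact fun z _ ↦ (differentiableAt_id.neg.const_cpow
        (Or.inl (by exact_mod_cast ha.1.ne'))).differentiableWithinAt
    · refine Complex.differentiableOn_tsum_of_summable_norm
        ((summable_nat_add_one_rpow hρ0).mul_left (2 * (R * (1 - |a|) ^ (-R - 1)))) hterm hUo ?_
      intro n z hz
      exact norm_hurwitzTerm_le ha' hρ0 (le_of_lt hz.1) (mem_ball_zero_iff.1 hz.2).le n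
  have hf : DifferentiableOn ℂ (fun z ↦ 2 * (HurwitzZeta.hurwitzZetaEven a z -
      HurwitzZeta.hurwitzZetaEven 0 z)) U :=
    ((HurwitzZeta.differentiable_hurwitzZetaEven_sub_hurwitzZetaEven a 0).const_mul
      2).differentiableOn
  refine (hf.analyticOnNhd hUo).eqOn_of_preconnected_of_eventuallyEq (hg.analyticOnNhd hUo)
    hUc h2U ?_ hsU
  have hnhds : {z : ℂ | 1 < z.re} ∈ 𝓝 ((s.re + 2 : ℝ) : ℂ) :=
    (isOpen_lt continuous_const Complex.continuous_re).mem_nhds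
      (by show 1 < (((s.re + 2 : ℝ) : ℂ)).re; rw [Complex.ofReal_re]; linarith)
  filter_upwards [hnhds] with z hz
  rw [(hasSum_hurwitzTerm ha hz).tsum_eq]
  ring

/-- The part of the even Hurwitz zeta function that is regular at `a = 0`, normalized to vanish
there. -/
noncomputable def hurwitzRegular (σ a : ℝ) : ℝ := ∑' n, hurwitzTermReal σ a n

lemma hurwitzRegular_neg (σ a : ℝ) : hurwitzRegular σ (-a) = hurwitzRegular σ a := by
  unfold hurwitzRegular hurwitzTermReal
  congr 1
  funext n
  rw [sub_neg_eq_add, ← sub_eq_add_neg]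
  ring

lemma strictConvexOn_rpow_neg {σ : ℝ} (hσ : 0 < σ) :
    StrictConvexOn ℝ (Ioi 0) fun u : ℝ ↦ u ^ (-σ) := by
  refine StrictMonoOn.strictConvexOn_of_deriv (convex_Ioi 0) ?_ ?_
  · exact fun u hu ↦ (Real.continuousAt_rpow_const u _ (Or.inl (ne_of_gt hu))).continuousWithinAt
  · rw [interior_Ioi]
    intro u hu v hv huv
    rw [Real.deriv_rpow_const, Real.deriv_rpow_const]
    have := Real.rpow_lt_rpow_of_neg hu huv (show -σ - 1 < 0 by linarith)
    nlinarith

lemma strictConvexOn_hurwitzTermReal {σ : ℝ} (hσ : 0 < σ) (n : ℕ) :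
    StrictConvexOn ℝ (Ioo (-1) 1) fun a ↦ hurwitzTermReal σ a n := by
  have hn : (0 : ℝ) ≤ n := n.cast_nonneg
  refine ⟨convex_Ioo _ _, fun a ha b hb hab p q hp hq hpq ↦ ?_⟩
  obtain ⟨ha1, ha2⟩ := ha
  obtain ⟨hb1, hb2⟩ := hb
  have h1 := (strictConvexOn_rpow_neg hσ).2 (x := n + 1 + a) (y := n + 1 + b)
    (by simp only [mem_Ioi]; linarith) (by simp only [mem_Ioi]; linarith)
    (by simpa using hab) hp hq hpq
  have h2 := (strictConvexOn_rpow_neg hσ).2 (x := n + 1 - a) (y := n + 1 - b)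
    (by simp only [mem_Ioi]; linarith) (by simp only [mem_Ioi]; linarith)
    (by simpa using hab) hp hq hpq
  simp only [smul_eq_mul] at h1 h2 ⊢
  have hq' : q = 1 - p := by linarith
  subst hq'
  unfold hurwitzTermReal
  rw [show p * (n + 1 + a) + (1 - p) * (n + 1 + b) = n + 1 + (p * a + (1 - p) * b) by ring] at h1
  rw [show p * (n + 1 - a) + (1 - p) * (n + 1 - b) = n + 1 - (p * a + (1 - p) * b) by ring] at h2
  linarith

lemma StrictConvexOn.tsum {ι : Type*} [Nonempty ι] {S : Set ℝ} {f : ℝ → ι → ℝ}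
    (hf : ∀ i, StrictConvexOn ℝ S fun a ↦ f a i) (hs : ∀ a ∈ S, Summable (f a)) :
    StrictConvexOn ℝ S fun a ↦ ∑' i, f a i := by
  obtain ⟨i₀⟩ := ‹Nonempty ι›
  refine ⟨(hf i₀).1, fun a ha b hb hab p q hp hq hpq ↦ ?_⟩
  have hsum : Summable fun i ↦ p * f a i + q * f b i :=
    ((hs a ha).mul_left p).add ((hs b hb).mul_left q)
  have hlt : ∀ i, f (p • a + q • b) i < p * f a i + q * f b i := fun i ↦ by
    simpa using (hf i).2 ha hb hab hp hq hpq
  have key := Summable.tsum_lt_tsum (fun i ↦ (hlt i).le) (hlt i₀)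
    (hs _ ((hf i₀).1 ha hb hp.le hq.le hpq)) hsum
  rwa [((hs a ha).mul_left p).tsum_add ((hs b hb).mul_left q), tsum_mul_left, tsum_mul_left] at key

lemma strictConvexOn_hurwitzRegular {σ : ℝ} (hσ : 0 < σ) :
    StrictConvexOn ℝ (Ioo (-1) 1) (hurwitzRegular σ) :=
  StrictConvexOn.tsum (strictConvexOn_hurwitzTermReal hσ)
    fun _ ha ↦ summable_hurwitzTermReal (abs_lt.2 ha) hσ

lemma exists_Cl_eq {σ : ℝ} (hσ : σ ∈ Ioo (0 : ℝ) 1) :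
    ∃ c > 0, ∃ d, ∀ x ∈ Ioo 0 (2 * π), Cl (1 - σ) x =
      c * ((x / (2 * π)) ^ (-σ) + hurwitzRegular σ (x / (2 * π))) + d := by
  obtain ⟨hσ0, hσ1⟩ := hσ
  have hcos : 0 < Real.cos (π * σ / 2) := by
    apply Real.cos_pos_of_mem_Ioo
    constructor <;> nlinarith [Real.pi_pos]
  have hG : 0 < Real.Gamma σ := Real.Gamma_pos_of_pos hσ0
  set c := 2 * (2 * π) ^ (-σ) * Real.Gamma σ * Real.cos (π * σ / 2) with hc
  have hc0 : 0 < c := by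
    have := Real.pi_pos
    positivity
  refine ⟨c / 2, by positivity, c * (HurwitzZeta.hurwitzZetaEven 0 σ).re, fun x hx ↦ ?_⟩
  have h2π : 0 < 2 * π := by linarith [Real.pi_pos]
  have ha : x / (2 * π) ∈ Ioo (0 : ℝ) 1 := ⟨div_pos hx.1 h2π, (div_lt_one h2π).2 hx.2⟩
  set a := x / (2 * π) with ha_def
  have ha' : |a| < 1 := abs_lt.2 ⟨by linarith [ha.1], ha.2⟩
  have hfe := HurwitzZeta.cosZeta_one_sub (a : UnitAddCircle) (s := (σ : ℂ)) (by
    intro n hn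
    have h : σ = 1 - n := by exact_mod_cast hn
    rcases n with _ | n
    · simp at h; linarith
    · push_cast at h; linarith [n.cast_nonneg (α := ℝ)])
  have hcc : (2 * (2 * (π : ℂ)) ^ (-(σ : ℂ)) * Complex.Gamma σ * Complex.cos (π * σ / 2)) =
      (c : ℂ) := by
    rw [hc, Complex.Gamma_ofReal]
    push_cast [Complex.ofReal_cpow h2π.le]
    rfl
  have hz := hurwitzZetaEven_sub_eq_tsum ha (s := (σ : ℂ)) (by simpa using hσ0)
  have hreal : (a : ℂ) ^ (-(σ : ℂ)) + ∑' n, hurwitzTerm a σ n =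
      ((a ^ (-σ) + hurwitzRegular σ a : ℝ) : ℂ) := by
    rw [hurwitzRegular]
    push_cast [Complex.ofReal_cpow ha.1.le]
    congr 2
    funext n
    exact hurwitzTerm_ofReal ha' σ n
  rw [hreal] at hz
  have hz' := congrArg Complex.re hz
  rw [Complex.ofReal_re, show (2 : ℂ) = ((2 : ℝ) : ℂ) by norm_num, Complex.re_ofReal_mul,
    Complex.sub_re] at hz'
  have hCl : Cl (1 - σ) x = c * (HurwitzZeta.hurwitzZetaEven (a : UnitAddCircle) σ).re := by
    rw [← Complex.re_ofReal_mul, ← hcc, ← hfe, Cl]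
    push_cast
    rfl
  rw [hCl, ← hz']
  ring

lemma Cl_two_pi_sub (s x : ℝ) : Cl s (2 * π - x) = Cl s x := by
  have h : ((((2 * π - x) / (2 * π) : ℝ)) : UnitAddCircle) =
      -((x / (2 * π) : ℝ) : UnitAddCircle) := by
    rw [sub_div, div_self (by positivity), AddCircle.coe_sub, AddCircle.coe_period, zero_sub]
  rw [Cl, h, HurwitzZeta.cosZeta_neg, Cl]

lemma rpow_neg_add_hurwitzRegular_one_sub {σ : ℝ} (hσ : σ ∈ Ioo (0 : ℝ) 1) {a : ℝ}
    (ha : a ∈ Ioo (0 : ℝ) 1) :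
    (1 - a) ^ (-σ) + hurwitzRegular σ (1 - a) = a ^ (-σ) + hurwitzRegular σ a := by
  obtain ⟨c, hc, d, h⟩ := exists_Cl_eq hσ
  have hπ := Real.pi_pos
  have e := Cl_two_pi_sub (1 - σ) (2 * π * a)
  rw [h _ ⟨by nlinarith [ha.1, ha.2], by nlinarith [ha.1, ha.2]⟩,
    h _ ⟨by nlinarith [ha.1, ha.2], by nlinarith [ha.1, ha.2]⟩] at e
  rw [show (2 * π - 2 * π * a) / (2 * π) = 1 - a by field_simp,
    show 2 * π * a / (2 * π) = a by field_simp] at e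
  exact mul_left_cancel₀ hc.ne' (add_right_cancel e)

lemma StrictConvexOn.add_lt_add_of_abs_lt {S : Set ℝ} {f : ℝ → ℝ} (hf : StrictConvexOn ℝ S f)
    {m u v : ℝ} (h1 : m - v ∈ S) (h2 : m + v ∈ S) (huv : |u| < v) :
    f (m - u) + f (m + u) < f (m - v) + f (m + v) := by
  obtain ⟨hu1, hu2⟩ := abs_lt.1 huv
  have hv : 0 < v := (abs_nonneg u).trans_lt huv
  have hp : 0 < (v + u) / (2 * v) := div_pos (by linarith) (by linarith)
  have hq : 0 < (v - u) / (2 * v) := div_pos (by linarith) (by linarith)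
  have hpq : (v + u) / (2 * v) + (v - u) / (2 * v) = 1 := by field_simp; ring
  have hne : m - v ≠ m + v := by intro h; linarith
  have a1 := hf.2 h1 h2 hne hp hq hpq
  have a2 := hf.2 h1 h2 hne hq hp (by rw [add_comm]; exact hpq)
  simp only [smul_eq_mul] at a1 a2
  rw [show (v + u) / (2 * v) * (m - v) + (v - u) / (2 * v) * (m + v) = m - u by
    field_simp; ring] at a1
  rw [show (v - u) / (2 * v) * (m - v) + (v + u) / (2 * v) * (m + v) = m + u by
    field_simp; ring] at a2
  have h3 : (v - u) / (2 * v) = 1 - (v + u) / (2 * v) := by linarith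
  rw [h3] at a1 a2
  linarith

/-- The combination `f (y (1 - t)) + f (y (1 + t)) - 2 f (y t)`. -/
noncomputable def threeTerm (f : ℝ → ℝ) (y t : ℝ) : ℝ :=
  f (y * (1 - t)) + f (y * (1 + t)) - 2 * f (y * t)

lemma mul_one_sub_mem {y t : ℝ} (hy : y ∈ Ioo (0 : ℝ) (1 / 2)) (ht : t ∈ Ioo (0 : ℝ) 1) :
    y * (1 - t) ∈ Ioo (0 : ℝ) (1 / 2) :=
  ⟨by nlinarith [hy.1, ht.2], by nlinarith [hy.1, hy.2, ht.1, ht.2]⟩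

lemma mul_one_add_mem {y t : ℝ} (hy : y ∈ Ioo (0 : ℝ) (1 / 2)) (ht : t ∈ Ioo (0 : ℝ) 1) :
    y * (1 + t) ∈ Ioo (0 : ℝ) 1 :=
  ⟨by nlinarith [hy.1, ht.1], by nlinarith [hy.1, hy.2, ht.1, ht.2]⟩

lemma mul_mem_Ioo_half {y t : ℝ} (hy : y ∈ Ioo (0 : ℝ) (1 / 2)) (ht : t ∈ Ioo (0 : ℝ) 1) :
    y * t ∈ Ioo (0 : ℝ) (1 / 2) :=
  ⟨by nlinarith [hy.1, ht.1], by nlinarith [hy.1, hy.2, ht.1, ht.2]⟩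

lemma StrictConvexOn.lt_of_symm_half {K : ℝ → ℝ} (hK : StrictConvexOn ℝ (Ioo 0 1) K)
    (hsymm : ∀ a ∈ Ioo (0 : ℝ) 1, K (1 - a) = K a) {a b : ℝ} (ha : 0 < a) (hab : a < b)
    (hb : b < 1 - a) : K b < K a := by
  have h := hK.add_lt_add_of_abs_lt (m := 1 / 2) (u := 1 / 2 - b) (v := 1 / 2 - a)
    ⟨by linarith, by linarith⟩ ⟨by linarith, by linarith⟩ (abs_lt.2 ⟨by linarith, by linarith⟩)
  rw [show (1 / 2 - (1 / 2 - b) : ℝ) = b by ring, show (1 / 2 + (1 / 2 - b) : ℝ) = 1 - b by ring,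
    show (1 / 2 - (1 / 2 - a) : ℝ) = a by ring, show (1 / 2 + (1 / 2 - a) : ℝ) = 1 - a by ring,
    hsymm a ⟨ha, by linarith⟩, hsymm b ⟨by linarith, by linarith⟩] at h
  linarith

lemma strictMonoOn_threeTerm {K : ℝ → ℝ} (hK : StrictConvexOn ℝ (Ioo 0 1) K)
    (hsymm : ∀ a ∈ Ioo (0 : ℝ) 1, K (1 - a) = K a) {y : ℝ} (hy : y ∈ Ioo (0 : ℝ) (1 / 2)) :
    StrictMonoOn (threeTerm K y) (Ioo 0 1) := by
  intro t ht u hu htu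
  have h1 := hK.add_lt_add_of_abs_lt (m := y) (u := y * t) (v := y * u)
    (by
      have := mul_one_sub_mem hy hu
      rw [mul_sub, mul_one] at this
      exact ⟨this.1, by linarith [this.2]⟩)
    (by
      have := mul_one_add_mem hy hu
      rwa [mul_add, mul_one] at this)
    (by
      rw [abs_of_pos (mul_pos hy.1 ht.1)]
      exact mul_lt_mul_of_pos_left htu hy.1)
  have h2 := hK.lt_of_symm_half hsymm (mul_mem_Ioo_half hy ht).1
    (mul_lt_mul_of_pos_left htu hy.1)
    (by linarith [(mul_mem_Ioo_half hy ht).2, (mul_mem_Ioo_half hy hu).2])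
  unfold threeTerm
  simp only [mul_sub, mul_add, mul_one]
  linarith

lemma continuousOn_threeTerm {K : ℝ → ℝ} (hK : ContinuousOn K (Ioo 0 1)) {y : ℝ}
    (hy : y ∈ Ioo (0 : ℝ) (1 / 2)) : ContinuousOn (threeTerm K y) (Ioo 0 1) := by
  have half : Ioo (0 : ℝ) (1 / 2) ⊆ Ioo 0 1 := Ioo_subset_Ioo_right (by norm_num)
  unfold threeTerm
  refine ((hK.comp (by fun_prop) fun t ht ↦ half (mul_one_sub_mem hy ht)).add
    (hK.comp (by fun_prop) fun t ht ↦ mul_one_add_mem hy ht)).sub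
    (continuousOn_const.mul (hK.comp (by fun_prop) fun t ht ↦ half (mul_mem_Ioo_half hy ht)))

lemma tendsto_threeTerm_zero {K : ℝ → ℝ} (hK : ContinuousOn K (Ioo 0 1))
    (hK0 : Tendsto K (𝓝[>] 0) atTop) {y : ℝ} (hy : y ∈ Ioo (0 : ℝ) (1 / 2)) :
    Tendsto (threeTerm K y) (𝓝[>] 0) atBot := by
  have hKy : ContinuousAt K y :=
    hK.continuousAt (Ioo_mem_nhds hy.1 (by linarith [hy.2]))
  have hsub : Tendsto (fun t : ℝ ↦ K (y * (1 - t))) (𝓝[>] 0) (𝓝 (K y)) := by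
    refine hKy.tendsto.comp (Tendsto.mono_left ?_ nhdsWithin_le_nhds)
    exact Continuous.tendsto' (by fun_prop) _ _ (by simp)
  have hadd : Tendsto (fun t : ℝ ↦ K (y * (1 + t))) (𝓝[>] 0) (𝓝 (K y)) := by
    refine hKy.tendsto.comp (Tendsto.mono_left ?_ nhdsWithin_le_nhds)
    exact Continuous.tendsto' (by fun_prop) _ _ (by simp)
  have hmul : Tendsto (fun t : ℝ ↦ K (y * t)) (𝓝[>] 0) atTop := by
    refine hK0.comp (tendsto_nhdsWithin_iff.2 ⟨Tendsto.mono_left ?_ nhdsWithin_le_nhds, ?_⟩)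
    · exact Continuous.tendsto' (by fun_prop) _ _ (by simp)
    · filter_upwards [self_mem_nhdsWithin] with t ht
      exact mul_pos hy.1 ht
  have h := (hsub.add hadd).add_atBot
    (tendsto_neg_atTop_atBot.comp (hmul.const_mul_atTop (zero_lt_two (α := ℝ))))
  exact h.congr fun t ↦ by simp [threeTerm, sub_eq_add_neg]

lemma tendsto_threeTerm_one {K : ℝ → ℝ} (hK : ContinuousOn K (Ioo 0 1))
    (hK0 : Tendsto K (𝓝[>] 0) atTop) {y : ℝ} (hy : y ∈ Ioo (0 : ℝ) (1 / 2)) :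
    Tendsto (threeTerm K y) (𝓝[<] 1) atTop := by
  have hKy : ContinuousAt K y :=
    hK.continuousAt (Ioo_mem_nhds hy.1 (by linarith [hy.2]))
  have hKy2 : ContinuousAt K (y * 2) :=
    hK.continuousAt (Ioo_mem_nhds (by linarith [hy.1]) (by linarith [hy.2]))
  have hmul : Tendsto (fun t : ℝ ↦ K (y * t)) (𝓝[<] 1) (𝓝 (K y)) := by
    refine hKy.tendsto.comp (Tendsto.mono_left ?_ nhdsWithin_le_nhds)
    exact Continuous.tendsto' (by fun_prop) _ _ (by simp)
  have hadd : Tendsto (fun t : ℝ ↦ K (y * (1 + t))) (𝓝[<] 1) (𝓝 (K (y * 2))) := by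
    refine hKy2.tendsto.comp (Tendsto.mono_left ?_ nhdsWithin_le_nhds)
    exact Continuous.tendsto' (by fun_prop) _ _ (by norm_num)
  have hsub : Tendsto (fun t : ℝ ↦ K (y * (1 - t))) (𝓝[<] 1) atTop := by
    refine hK0.comp (tendsto_nhdsWithin_iff.2 ⟨Tendsto.mono_left ?_ nhdsWithin_le_nhds, ?_⟩)
    · exact Continuous.tendsto' (by fun_prop) _ _ (by simp)
    · filter_upwards [self_mem_nhdsWithin] with t ht
      exact mul_pos hy.1 (sub_pos.2 ht)
  have h := hsub.atTop_add (hadd.sub (hmul.const_mul 2))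
  exact h.congr fun t ↦ by simp [threeTerm]; ring

lemma exists_root_Ioo {f : ℝ → ℝ} (hf : ContinuousOn f (Ioo 0 1))
    (h0 : Tendsto f (𝓝[>] 0) atBot) (h1 : Tendsto f (𝓝[<] 1) atTop) :
    ∃ r ∈ Ioo (0 : ℝ) 1, f r = 0 := by
  obtain ⟨a, ha, hfa⟩ := ((h0.eventually_lt_atBot 0).and
    (Ioo_mem_nhdsGT (zero_lt_one (α := ℝ)))).exists
  obtain ⟨b, hb, hfb⟩ := ((h1.eventually_gt_atTop 0).and
    (Ioo_mem_nhdsLT (zero_lt_one (α := ℝ)))).exists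
  obtain ⟨r, hr, hr0⟩ := isPreconnected_Ioo.intermediate_value hfa hfb hf ⟨ha.le, hb.le⟩
  exact ⟨r, hr, hr0⟩

lemma lt_of_even_strictConvexOn {H : ℝ → ℝ} (hH : StrictConvexOn ℝ (Ioo (-1) 1) H)
    (heven : ∀ a, H (-a) = H a) {a b : ℝ} (ha : 0 ≤ a) (hab : a < b) (hb : b < 1) : H a < H b := by
  have h := hH.add_lt_add_of_abs_lt (m := 0) (u := a) (v := b)
    ⟨by linarith, by linarith⟩ ⟨by linarith, by linarith⟩ (by rwa [abs_of_nonneg ha])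
  simp only [zero_sub, zero_add, heven] at h
  linarith

lemma threeTerm_pos_of_even {H : ℝ → ℝ} (hH : StrictConvexOn ℝ (Ioo (-1) 1) H)
    (heven : ∀ a, H (-a) = H a) {y t : ℝ} (hy : y ∈ Ioo (0 : ℝ) (1 / 2)) (ht : t ∈ Ioo (0 : ℝ) 1) :
    0 < threeTerm H y t := by
  have m1 := mul_one_sub_mem hy ht
  have m2 := mul_one_add_mem hy ht
  have m3 := mul_mem_Ioo_half hy ht
  rw [mul_sub, mul_one] at m1
  rw [mul_add, mul_one] at m2
  have h1 := hH.add_lt_add_of_abs_lt (m := y) (u := 0) (v := y * t)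
    ⟨by linarith [m1.1], by linarith [m1.2]⟩ ⟨by linarith [m2.1], m2.2⟩ (by simpa using m3.1)
  have h2 := lt_of_even_strictConvexOn hH heven m3.1.le
    (mul_lt_of_lt_one_right hy.1 ht.2) (by linarith [hy.2])
  simp only [sub_zero, add_zero] at h1
  unfold threeTerm
  simp only [mul_sub, mul_add, mul_one]
  linarith

lemma threeTerm_mono_of_even {H : ℝ → ℝ} (hH : StrictConvexOn ℝ (Ioo (-1) 1) H)
    (heven : ∀ a, H (-a) = H a) {y z t : ℝ} (hy : y ∈ Ioo (0 : ℝ) (1 / 2))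
    (hz : z ∈ Ioo (0 : ℝ) (1 / 2)) (hyz : y < z) (ht : t ∈ Ioo (0 : ℝ) 1) :
    threeTerm H y t ≤ threeTerm H z t := by
  have mem : ∀ a, 0 < a → a < 1 → a ∈ Ioo (-1 : ℝ) 1 := fun a h0 h1 ↦ ⟨by linarith, h1⟩
  have y1 := mul_one_sub_mem hy ht
  have z1 := mul_one_sub_mem hz ht
  have y2 := mul_one_add_mem hy ht
  have z2 := mul_one_add_mem hz ht
  have y3 := mul_mem_Ioo_half hy ht
  have z3 := mul_mem_Ioo_half hz ht
  have hA : y * t < z * t := mul_lt_mul_of_pos_right hyz ht.1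
  have hB : y * (1 + t) < z * (1 + t) := mul_lt_mul_of_pos_right hyz (by linarith [ht.1])
  have hyB : y * t < y * (1 + t) := mul_lt_mul_of_pos_left (by linarith) hy.1
  have hzB : z * t < z * (1 + t) := mul_lt_mul_of_pos_left (by linarith) hz.1
  have h1 : H (y * (1 - t)) < H (z * (1 - t)) :=
    lt_of_even_strictConvexOn hH heven y1.1.le
      (mul_lt_mul_of_pos_right hyz (by linarith [ht.2])) (by linarith [z1.2])
  have h2 : H (y * t) < H (z * t) :=
    lt_of_even_strictConvexOn hH heven y3.1.le hA (by linarith [z3.2])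
  have s1 := hH.convexOn.secant_mono (a := y * t) (x := z * t) (y := z * (1 + t))
    (mem _ y3.1 (by linarith [y3.2])) (mem _ z3.1 (by linarith [z3.2])) (mem _ z2.1 z2.2)
    hA.ne' (hA.trans hzB).ne' hzB.le
  have s2 := hH.convexOn.secant_mono (a := z * (1 + t)) (x := y * t) (y := y * (1 + t))
    (mem _ z2.1 z2.2) (mem _ y3.1 (by linarith [y3.2])) (mem _ y2.1 y2.2)
    (hA.trans hzB).ne hB.ne hyB.le
  rw [← neg_div_neg_eq, neg_sub, neg_sub,
    ← neg_div_neg_eq (H (y * (1 + t)) - H (z * (1 + t))), neg_sub, neg_sub] at s2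
  have s := s1.trans s2
  rw [← sub_mul, ← sub_mul, div_le_div_iff₀ (mul_pos (sub_pos.2 hyz) ht.1)
    (mul_pos (sub_pos.2 hyz) (by linarith [ht.1]))] at s
  have s' : (H (z * t) - H (y * t)) * (1 + t) ≤ (H (z * (1 + t)) - H (y * (1 + t))) * t := by
    have hd : 0 < z - y := sub_pos.2 hyz
    refine le_of_mul_le_mul_right ?_ hd
    nlinarith
  have s3 : 2 * (H (z * t) - H (y * t)) ≤ H (z * (1 + t)) - H (y * (1 + t)) := by
    refine le_of_mul_le_mul_right (le_trans ?_ s') ht.1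
    nlinarith [ht.2]
  unfold threeTerm
  linarith

lemma threeTerm_rpow_add {σ : ℝ} (H : ℝ → ℝ) {y t : ℝ} (hy : 0 < y) (ht : t ∈ Ioo (0 : ℝ) 1) :
    threeTerm (fun a ↦ a ^ (-σ) + H a) y t =
      y ^ (-σ) * ((1 - t) ^ (-σ) + (1 + t) ^ (-σ) - 2 * t ^ (-σ)) + threeTerm H y t := by
  simp only [threeTerm]
  rw [Real.mul_rpow hy.le (by linarith [ht.2]), Real.mul_rpow hy.le (by linarith [ht.1]),
    Real.mul_rpow hy.le ht.1.le]
  ring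

lemma continuousOn_rpow_neg_add {σ : ℝ} {H : ℝ → ℝ} (hH : ContinuousOn H (Ioo (-1) 1)) :
    ContinuousOn (fun a ↦ a ^ (-σ) + H a) (Ioo 0 1) :=
  ContinuousOn.add
    (fun u hu ↦ (Real.continuousAt_rpow_const u _ (Or.inl hu.1.ne')).continuousWithinAt)
    (hH.mono (Ioo_subset_Ioo_left (by norm_num)))

lemma tendsto_rpow_neg_add {σ : ℝ} (hσ : 0 < σ) {H : ℝ → ℝ} (hH : ContinuousOn H (Ioo (-1) 1)) :
    Tendsto (fun a ↦ a ^ (-σ) + H a) (𝓝[>] 0) atTop :=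
  (tendsto_rpow_neg_nhdsGT_zero (neg_lt_zero.2 hσ)).atTop_add
    ((hH.continuousAt (Ioo_mem_nhds (by norm_num) (by norm_num))).tendsto.mono_left
      nhdsWithin_le_nhds)

lemma exists_root_rpow {σ : ℝ} (hσ : 0 < σ) :
    ∃ r ∈ Ioo (0 : ℝ) 1, (1 - r) ^ (-σ) + (1 + r) ^ (-σ) - 2 * r ^ (-σ) = 0 := by
  have hy : (1 / 4 : ℝ) ∈ Ioo (0 : ℝ) (1 / 2) := by norm_num
  have hc := continuousOn_rpow_neg_add (σ := σ) (H := fun _ ↦ 0) continuousOn_const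
  have h0 := tendsto_rpow_neg_add hσ (H := fun _ ↦ 0) continuousOn_const
  obtain ⟨r, hr, hr0⟩ := exists_root_Ioo (continuousOn_threeTerm hc hy)
    (tendsto_threeTerm_zero hc h0 hy) (tendsto_threeTerm_one hc h0 hy)
  refine ⟨r, hr, ?_⟩
  rw [threeTerm_rpow_add _ hy.1 hr] at hr0
  have hpos : (0 : ℝ) < (1 / 4) ^ (-σ) := by positivity
  rw [show threeTerm (fun _ ↦ (0 : ℝ)) (1 / 4) r = 0 by simp [threeTerm], add_zero] at hr0
  exact (mul_eq_zero.1 hr0).resolve_left hpos.ne'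

lemma Ihat_eq_threeTerm {α c d : ℝ} {K : ℝ → ℝ}
    (h : ∀ x ∈ Ioo 0 (2 * π), Cl (-α) x = c * K (x / (2 * π)) + d) {x t : ℝ}
    (hx : x ∈ Ioo 0 π) (ht : t ∈ Ioo (0 : ℝ) 1) :
    Ihat α x t = c * threeTerm K (x / (2 * π)) t := by
  have hπ := Real.pi_pos
  obtain ⟨hx0, hx1⟩ := hx
  obtain ⟨ht0, ht1⟩ := ht
  unfold Ihat threeTerm
  rw [h (x * (1 - t)) ⟨by nlinarith, by nlinarith⟩, h (x * (1 + t)) ⟨by nlinarith, by nlinarith⟩,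
    h (x * t) ⟨by nlinarith, by nlinarith⟩]
  simp only [mul_div_right_comm]
  ring

/-- For each `x ∈ (0,π)` the map `t ↦ Î_α(x,t)` is strictly increasing and continuous on
`(0,1)`, tends to `-∞` at `0⁺` and `+∞` at `1⁻`; its unique root `r_{α,x}` is decreasing
in `x` and satisfies `1/2 < r_{α,x} < r_{α,0}`. -/
theorem Ihat_root_properties (α : ℝ) (hα : α ∈ Set.Ioo (-1 : ℝ) 0) :
    (∀ x ∈ Set.Ioo (0 : ℝ) π,
      StrictMonoOn (Ihat α x) (Set.Ioo 0 1) ∧ ContinuousOn (Ihat α x) (Set.Ioo 0 1) ∧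
      Tendsto (Ihat α x) (𝓝[>] (0 : ℝ)) atBot ∧
      Tendsto (Ihat α x) (𝓝[<] (1 : ℝ)) atTop) ∧
    ∃ r₀ ∈ Set.Ioo (0 : ℝ) 1,
      ((1 - r₀) ^ (-α - 1) + (1 + r₀) ^ (-α - 1) - 2 * r₀ ^ (-α - 1) = 0) ∧
      ∃ r : ℝ → ℝ,
        (∀ x ∈ Set.Ioo (0 : ℝ) π, r x ∈ Set.Ioo (0 : ℝ) 1 ∧ Ihat α x (r x) = 0 ∧
          ∀ t ∈ Set.Ioo (0 : ℝ) 1, Ihat α x t = 0 → t = r x) ∧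
        (∀ x₁ ∈ Set.Ioo (0 : ℝ) π, ∀ x₂ ∈ Set.Ioo (0 : ℝ) π, x₁ ≤ x₂ → r x₂ ≤ r x₁) ∧
        (∀ x ∈ Set.Ioo (0 : ℝ) π, 1/2 < r x ∧ r x < r₀) := by
  have hπ := Real.pi_pos
  obtain ⟨σ, hσα⟩ : ∃ σ, σ = 1 + α := ⟨_, rfl⟩
  have hσ : σ ∈ Ioo (0 : ℝ) 1 := ⟨by linarith [hα.1], by linarith [hα.2]⟩
  rw [show -α - 1 = -σ by rw [hσα]; ring]
  set H := hurwitzRegular σ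
  have hH : StrictConvexOn ℝ (Ioo (-1) 1) H := strictConvexOn_hurwitzRegular hσ.1
  have heven : ∀ a, H (-a) = H a := hurwitzRegular_neg σ
  have hHc : ContinuousOn H (Ioo (-1) 1) := hH.convexOn.continuousOn isOpen_Ioo
  set K : ℝ → ℝ := fun a ↦ a ^ (-σ) + H a with hKdef
  have hsymm : ∀ a ∈ Ioo (0 : ℝ) 1, K (1 - a) = K a :=
    fun a ha ↦ rpow_neg_add_hurwitzRegular_one_sub hσ ha
  have hKconv : StrictConvexOn ℝ (Ioo 0 1) K :=
    ((strictConvexOn_rpow_neg hσ.1).subset Ioo_subset_Ioi_self (convex_Ioo _ _)).add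
      (hH.subset (Ioo_subset_Ioo_left (by norm_num)) (convex_Ioo _ _))
  have hKc : ContinuousOn K (Ioo 0 1) := continuousOn_rpow_neg_add hHc
  have hK0 : Tendsto K (𝓝[>] 0) atTop := tendsto_rpow_neg_add hσ.1 hHc
  obtain ⟨c, hc, d, hCl⟩ := exists_Cl_eq hσ
  rw [show 1 - σ = -α by rw [hσα]; ring] at hCl
  have hI : ∀ x ∈ Ioo 0 π, EqOn (Ihat α x) (fun t ↦ c * threeTerm K (x / (2 * π)) t) (Ioo 0 1) :=
    fun x hx t ht ↦ Ihat_eq_threeTerm (K := K) hCl hx ht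
  have hy : ∀ x ∈ Ioo 0 π, x / (2 * π) ∈ Ioo (0 : ℝ) (1 / 2) := fun x hx ↦
    ⟨div_pos hx.1 (by linarith), by rw [div_lt_iff₀ (by linarith)]; linarith [hx.2]⟩
  have hmain : ∀ x ∈ Set.Ioo (0 : ℝ) π,
      StrictMonoOn (Ihat α x) (Set.Ioo 0 1) ∧ ContinuousOn (Ihat α x) (Set.Ioo 0 1) ∧
      Tendsto (Ihat α x) (𝓝[>] (0 : ℝ)) atBot ∧
      Tendsto (Ihat α x) (𝓝[<] (1 : ℝ)) atTop := by
    intro x hx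
    refine ⟨?_, ?_, ?_, ?_⟩
    · intro t ht u hu htu
      rw [hI x hx ht, hI x hx hu]
      exact mul_lt_mul_of_pos_left (strictMonoOn_threeTerm hKconv hsymm (hy x hx) ht hu htu) hc
    · exact (continuousOn_const.mul (continuousOn_threeTerm hKc (hy x hx))).congr (hI x hx)
    · refine ((tendsto_threeTerm_zero hKc hK0 (hy x hx)).const_mul_atBot hc).congr' ?_
      filter_upwards [Ioo_mem_nhdsGT (zero_lt_one (α := ℝ))] with t ht
      exact (hI x hx ht).symm
    · refine ((tendsto_threeTerm_one hKc hK0 (hy x hx)).const_mul_atTop hc).congr' ?_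
      filter_upwards [Ioo_mem_nhdsLT (zero_lt_one (α := ℝ))] with t ht
      exact (hI x hx ht).symm
  refine ⟨hmain, ?_⟩
  obtain ⟨r₀, hr₀, hroot₀⟩ := exists_root_rpow hσ.1
  refine ⟨r₀, hr₀, hroot₀, ?_⟩
  have hex : ∀ x, ∃ r, x ∈ Ioo 0 π → r ∈ Ioo (0 : ℝ) 1 ∧ Ihat α x r = 0 := by
    intro x
    by_cases hx : x ∈ Ioo 0 π
    · obtain ⟨-, h2, h3, h4⟩ := hmain x hx
      obtain ⟨r, hr⟩ := exists_root_Ioo h2 h3 h4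
      exact ⟨r, fun _ ↦ hr⟩
    · exact ⟨0, fun h ↦ absurd h hx⟩
  choose r hr using hex
  refine ⟨r, fun x hx ↦ ⟨(hr x hx).1, (hr x hx).2, fun t ht h0 ↦ ?_⟩, ?_, fun x hx ↦ ⟨?_, ?_⟩⟩
  · exact (hmain x hx).1.injOn ht (hr x hx).1 (h0.trans (hr x hx).2.symm)
  · intro x hx z hz hxz
    rcases hxz.eq_or_lt with rfl | hxz
    · exact le_rfl
    obtain ⟨ht, h0⟩ := hr x hx
    rw [← (hmain z hz).1.le_iff_le (hr z hz).1 ht, (hr z hz).2, hI z hz ht]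
    rw [hI x hx ht] at h0
    have h0' := (mul_eq_zero.1 h0).resolve_left hc.ne'
    refine mul_nonneg hc.le ?_
    have hyz : x / (2 * π) < z / (2 * π) := by gcongr
    have hpos := threeTerm_pos_of_even hH heven (hy x hx) ht
    have hmono := threeTerm_mono_of_even hH heven (hy x hx) (hy z hz) hyz ht
    rw [threeTerm_rpow_add _ (hy x hx).1 ht] at h0'
    rw [threeTerm_rpow_add _ (hy z hz).1 ht]
    set k := (1 - r x) ^ (-σ) + (1 + r x) ^ (-σ) - 2 * r x ^ (-σ)
    have hpow : (z / (2 * π)) ^ (-σ) ≤ (x / (2 * π)) ^ (-σ) :=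
      Real.rpow_le_rpow_of_nonpos (hy x hx).1 hyz.le (by linarith [hσ.1])
    have hxpow : 0 < (x / (2 * π)) ^ (-σ) := Real.rpow_pos_of_pos (hy x hx).1 _
    have hk : k ≤ 0 := by
      by_contra! hk
      nlinarith [mul_pos hxpow hk]
    nlinarith [mul_nonneg (sub_nonneg.2 hpow) (neg_nonneg.2 hk)]
  · have hhalf : (1 / 2 : ℝ) ∈ Ioo (0 : ℝ) 1 := by norm_num
    rw [← (hmain x hx).1.lt_iff_lt hhalf (hr x hx).1, (hr x hx).2, hI x hx hhalf]
    refine mul_neg_of_pos_of_neg hc ?_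
    obtain ⟨hy0, hy1⟩ := hy x hx
    set y := x / (2 * π)
    have := hKconv.lt_of_symm_half hsymm (a := y * (1 / 2)) (b := y * (1 + 1 / 2))
      (by linarith) (by linarith) (by linarith)
    unfold threeTerm
    rw [show (1 : ℝ) - 1 / 2 = 1 / 2 by norm_num]
    linarith
  · rw [← (hmain x hx).1.lt_iff_lt (hr x hx).1 hr₀, (hr x hx).2, hI x hx hr₀]
    refine mul_pos hc ?_
    rw [threeTerm_rpow_add _ (hy x hx).1 hr₀, hroot₀, mul_zero, zero_add]
    exact threeTerm_pos_of_even hH heven (hy x hx) hr₀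
end

section
/- Let −1 < a ≤ b < 0 and x ∈ (0, π). For α ∈ [a, b], let r_{α,x} ∈ (0, 1) be the unique root in t of Î_α(x, t) := C_{−α}(x(1 − t)) + C_{−α}(x(1 + t)) − 2C_{−α}(xt). If the derivative (d/dα) Î_α(x, r_{a,x}) is strictly positive for all α ∈ [a, b], then r_{α,x} ≤ r_{a,x} for all α ∈ [a, b]. Similarly, if (d/dα) Î_α(x, r_{b,x}) > 0 for all α ∈ [a, b], then r_{α,x} ≥ r_{b,x} for all α ∈ [a, b]. -/
open scoped Real Topology
open Set

open MeasureTheory Filter Asymptotics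

/-- The generating function `∑_{n ≥ 1} cos (n x) e^{-n t}` in closed form, as a function of
`c = cos x`. -/
noncomputable def clausenKernel (c t : ℝ) : ℝ :=
  (c - Real.exp (-t)) / (2 * (Real.cosh t - c))

lemma hasSum_cos_mul_exp_neg (x : ℝ) {t : ℝ} (ht : 0 < t) :
    HasSum (fun n : ℕ => Real.cos ((n + 1 : ℕ) * x) * Real.exp (-(n + 1 : ℕ) * t))
      (clausenKernel (Real.cos x) t) := by
  set z : ℂ := Complex.exp (-t + x * Complex.I) with hz
  have hnorm : ‖z‖ < 1 := by
    rw [hz, Complex.norm_exp]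
    simpa using ht
  have key := Complex.hasSum_re ((hasSum_geometric_of_norm_lt_one hnorm).mul_left z)
  have hzre : z.re = Real.exp (-t) * Real.cos x := by simp [hz, Complex.exp_re]
  have hzim : z.im = Real.exp (-t) * Real.sin x := by simp [hz, Complex.exp_im]
  have hval : (z * (1 - z)⁻¹).re = clausenKernel (Real.cos x) t := by
    have hE : Real.exp (-t) * Real.exp t = 1 := by rw [← Real.exp_add]; simp
    have hlt : Real.cos x < Real.cosh t :=
      (Real.cos_le_one x).trans_lt (Real.one_lt_cosh.2 ht.ne')
    have hEpos := Real.exp_pos (-t)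
    have hcosh : 2 * Real.exp (-t) * Real.cosh t = 1 + Real.exp (-t) ^ 2 := by
      rw [Real.cosh_eq]; linear_combination hE
    have hns : Complex.normSq (1 - z) =
        2 * Real.exp (-t) * (Real.cosh t - Real.cos x) := by
      rw [Complex.normSq_apply]
      simp only [Complex.sub_re, Complex.sub_im, Complex.one_re, Complex.one_im, hzre, hzim]
      linear_combination -hcosh + Real.exp (-t) ^ 2 * Real.sin_sq_add_cos_sq x
    rw [Complex.mul_re, Complex.inv_re, Complex.inv_im, hns, clausenKernel]
    simp only [Complex.sub_re, Complex.sub_im, Complex.one_re, Complex.one_im, hzre, hzim]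
    have h1 : Real.cosh t - Real.cos x ≠ 0 := (sub_pos.2 hlt).ne'
    field_simp
    linear_combination -Real.exp (-t) * Real.sin_sq_add_cos_sq x
  rw [hval] at key
  refine key.congr_fun fun n => ?_
  have : z * z ^ n = Complex.exp (((-(n + 1 : ℕ) * t : ℝ) : ℂ)
      + (((n + 1 : ℕ) * x : ℝ) : ℂ) * Complex.I) := by
    rw [← pow_succ', hz, ← Complex.exp_nat_mul]
    congr 1
    push_cast
    ring
  rw [this, Complex.exp_re]
  simp [mul_comm]

lemma norm_clausenKernel_le {c t : ℝ} (hc : -1 ≤ c) (hc1 : c < 1) (ht : 0 < t) :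
    |clausenKernel c t| ≤ 4 / (1 - c) * Real.exp (-t) := by
  have h1 : 1 ≤ Real.cosh t := Real.one_le_cosh t
  have h2 : Real.exp t / 2 ≤ Real.cosh t := by
    rw [Real.cosh_eq]; linarith [Real.exp_pos (-t)]
  have hE1 : Real.exp (-t) < 1 := by simpa using ht
  have hE0 := Real.exp_pos (-t)
  have hd : 0 < 1 - c := by linarith
  have hden : (1 - c) / 2 * Real.exp t ≤ 2 * (Real.cosh t - c) := by nlinarith
  have hnum : |c - Real.exp (-t)| ≤ 2 := abs_le.2 ⟨by linarith, by linarith⟩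
  have hpos : 0 < (1 - c) / 2 * Real.exp t := by positivity
  rw [clausenKernel, abs_div, abs_of_pos (hpos.trans_le hden)]
  calc |c - Real.exp (-t)| / (2 * (Real.cosh t - c))
      ≤ 2 / ((1 - c) / 2 * Real.exp t) := by gcongr
    _ = 4 / (1 - c) * Real.exp (-t) := by
      rw [Real.exp_neg]; field_simp; norm_num

lemma continuous_clausenKernel {c : ℝ} (hc1 : c < 1) : Continuous (clausenKernel c) := by
  unfold clausenKernel
  refine Continuous.div (by fun_prop) (by fun_prop) fun t => ?_
  have := Real.one_le_cosh t
  exact (by linarith : 0 < 2 * (Real.cosh t - c)).ne'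

lemma cos_lt_one_of_mem_Ioo {x : ℝ} (hx : x ∈ Ioo 0 (2 * π)) : Real.cos x < 1 := by
  refine lt_of_le_of_ne (Real.cos_le_one x) fun h => ?_
  exact hx.1.ne' ((Real.cos_eq_one_iff_of_lt_of_lt (by linarith [hx.1, Real.pi_pos]) hx.2).1 h)

lemma differentiableAt_mellin_clausenKernel {c : ℝ} (hc : -1 ≤ c) (hc1 : c < 1) {s : ℂ}
    (hs : 0 < s.re) :
    DifferentiableAt ℂ (mellin fun t => (clausenKernel c t : ℂ)) s := by
  refine mellin_differentiableAt_of_isBigO_rpow_exp (a := 1) (b := 0) one_pos ?_ ?_ ?_ hs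
  · exact (Complex.continuous_ofReal.comp
      (continuous_clausenKernel hc1)).locallyIntegrable.locallyIntegrableOn _
  · refine IsBigO.of_bound (4 / (1 - c)) ?_
    filter_upwards [eventually_gt_atTop 0] with t ht
    simpa [Complex.norm_real] using norm_clausenKernel_le hc hc1 ht
  · refine IsBigO.of_bound (4 / (1 - c)) ?_
    filter_upwards [self_mem_nhdsWithin] with t ht
    have hE1 : Real.exp (-t) ≤ 1 := by simpa using (mem_Ioi.1 ht).le
    have hd : 0 < 1 - c := by linarith
    simpa [Complex.norm_real] using (norm_clausenKernel_le hc hc1 ht).trans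
      (mul_le_of_le_one_right (by positivity) hE1)

lemma mellin_clausenKernel_of_one_lt_re (x : ℝ) {s : ℂ} (hs : 1 < s.re) :
    mellin (fun t => (clausenKernel (Real.cos x) t : ℂ)) s =
      Complex.Gamma s * HurwitzZeta.cosZeta (↑(x / (2 * π)) : UnitAddCircle) s := by
  have h1 := HurwitzZeta.hasSum_nat_cosZeta (x / (2 * π)) hs
  have h0 : s ≠ 0 := fun h => by rw [h] at hs; norm_num at hs
  rw [← hasSum_nat_add_iff' 1] at h1
  simp only [Finset.range_one, Finset.sum_singleton, Nat.cast_zero, Complex.zero_cpow h0,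
    div_zero, sub_zero] at h1
  have h2 := hasSum_mellin (a := fun n : ℕ => ((Real.cos ((n + 1 : ℕ) * x) : ℝ) : ℂ))
    (p := fun n : ℕ => ((n + 1 : ℕ) : ℝ)) (s := s)
    (F := fun t => (clausenKernel (Real.cos x) t : ℂ))
    (fun n => Or.inr (by positivity)) (by linarith)
    (fun t ht => by exact_mod_cast Complex.hasSum_ofReal.2 (hasSum_cos_mul_exp_neg x ht))
    (by
      have := (summable_nat_add_iff 1).2 (Real.summable_one_div_nat_rpow.2 hs)
      refine this.of_nonneg_of_le (fun n => by positivity) fun n => ?_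
      gcongr
      rw [Complex.norm_real]
      exact Real.abs_cos_le_one _)
  refine h2.unique ((h1.mul_left (Complex.Gamma s)).congr_fun fun n => ?_)
  have : 2 * π * (x / (2 * π)) * ((n + 1 : ℕ) : ℝ) = (n + 1 : ℕ) * x := by
    have := Real.pi_ne_zero
    field_simp
  rw [this, mul_div_assoc]
  norm_cast

lemma mellin_clausenKernel {x : ℝ} (hx : x ∈ Ioo 0 (2 * π)) {s : ℂ} (hs : 0 < s.re) :
    mellin (fun t => (clausenKernel (Real.cos x) t : ℂ)) s =
      Complex.Gamma s * HurwitzZeta.cosZeta (↑(x / (2 * π)) : UnitAddCircle) s := by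
  have hπ := Real.pi_pos
  have hne : (↑(x / (2 * π)) : UnitAddCircle) ≠ 0 := by
    intro h
    obtain ⟨n, hn⟩ := (AddCircle.coe_eq_zero_iff (1 : ℝ)).1 h
    have h0 : 0 < x / (2 * π) := div_pos hx.1 (by positivity)
    have h1 : x / (2 * π) < 1 := (div_lt_one (by positivity)).2 hx.2
    rw [← hn, zsmul_eq_mul, mul_one] at h0 h1
    norm_cast at h0 h1
    omega
  have hopen : IsOpen {z : ℂ | 0 < z.re} := isOpen_lt continuous_const Complex.continuous_re
  have hL : AnalyticOnNhd ℂ (mellin fun t => (clausenKernel (Real.cos x) t : ℂ))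
      {z : ℂ | 0 < z.re} :=
    DifferentiableOn.analyticOnNhd (fun z hz => (differentiableAt_mellin_clausenKernel
      (Real.neg_one_le_cos x) (cos_lt_one_of_mem_Ioo hx) hz).differentiableWithinAt) hopen
  have hR : AnalyticOnNhd ℂ (fun z => Complex.Gamma z *
      HurwitzZeta.cosZeta (↑(x / (2 * π)) : UnitAddCircle) z) {z : ℂ | 0 < z.re} := by
    refine DifferentiableOn.analyticOnNhd (fun z hz => ?_) hopen
    refine DifferentiableAt.differentiableWithinAt (DifferentiableAt.mul ?_
      (HurwitzZeta.differentiable_cosZeta_of_ne_zero hne z))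
    refine Complex.differentiableAt_Gamma z fun m hm => ?_
    have : (0 : ℝ) < -m := by simpa [hm] using hz
    linarith [(Nat.cast_nonneg m : (0 : ℝ) ≤ m)]
  refine hL.eqOn_of_preconnected_of_eventuallyEq hR
    (convex_halfSpace_re_gt 0).isPreconnected (z₀ := 2) (by simp) ?_ hs
  filter_upwards [(isOpen_lt continuous_const Complex.continuous_re).mem_nhds
    (show (1 : ℝ) < (2 : ℂ).re by norm_num)] with z hz
  exact mellin_clausenKernel_of_one_lt_re x hz

lemma Cl_eq_integral {s x : ℝ} (hs : 0 < s) (hx : x ∈ Ioo 0 (2 * π)) :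
    Cl s x = (Real.Gamma s)⁻¹ *
      ∫ t in Ioi (0 : ℝ), t ^ (s - 1) * clausenKernel (Real.cos x) t := by
  have h := mellin_clausenKernel hx (s := (s : ℂ)) (by simpa using hs)
  have hm : mellin (fun t => (clausenKernel (Real.cos x) t : ℂ)) (s : ℂ) =
      ((∫ t in Ioi (0 : ℝ), t ^ (s - 1) * clausenKernel (Real.cos x) t : ℝ) : ℂ) := by
    rw [mellin, ← integral_complex_ofReal]
    refine setIntegral_congr_fun measurableSet_Ioi fun t ht => ?_
    simp [Complex.ofReal_cpow (mem_Ioi.1 ht).le]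
  rw [hm, Complex.Gamma_ofReal] at h
  have h' := congrArg Complex.re h
  rw [Complex.ofReal_re, Complex.re_ofReal_mul] at h'
  rw [Cl, h', inv_mul_cancel_left₀ (Real.Gamma_pos_of_pos hs).ne']

lemma integrableOn_rpow_mul_clausenKernel {s c : ℝ} (hs : 0 < s) (hc : -1 ≤ c) (hc1 : c < 1) :
    IntegrableOn (fun t : ℝ => t ^ (s - 1) * clausenKernel c t) (Ioi 0) := by
  refine Integrable.mono' (((Real.GammaIntegral_convergent hs).const_mul (4 / (1 - c)))) ?_ ?_
  · exact ((measurable_id.pow_const _).mul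
      (continuous_clausenKernel hc1).measurable).aestronglyMeasurable
  · filter_upwards [ae_restrict_mem measurableSet_Ioi] with t ht
    have ht0 : 0 ≤ t ^ (s - 1) := Real.rpow_nonneg (mem_Ioi.1 ht).le _
    rw [Real.norm_eq_abs, abs_mul, abs_of_nonneg ht0]
    calc t ^ (s - 1) * |clausenKernel c t|
        ≤ t ^ (s - 1) * (4 / (1 - c) * Real.exp (-t)) :=
          mul_le_mul_of_nonneg_left (norm_clausenKernel_le hc hc1 ht) ht0
      _ = _ := by ring

lemma continuousOn_Cl {s : ℝ} (hs : 0 < s) : ContinuousOn (Cl s) (Ioo 0 (2 * π)) := by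
  refine ContinuousOn.congr (f := fun x => (Real.Gamma s)⁻¹ *
      ∫ t in Ioi (0 : ℝ), t ^ (s - 1) * clausenKernel (Real.cos x) t) ?_
    fun x hx => Cl_eq_integral hs hx
  intro x hx
  refine ContinuousAt.continuousWithinAt (continuousAt_const.mul ?_)
  have hcx := cos_lt_one_of_mem_Ioo hx
  obtain ⟨d, hd, hd1⟩ := exists_between hcx
  have hev : ∀ᶠ y in 𝓝 x, Real.cos y < d :=
    Real.continuous_cos.continuousAt.eventually_lt continuousAt_const hd
  have hd0 : 0 < 1 - d := by linarith
  refine continuousAt_of_dominated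
    (bound := fun t => 4 / (1 - d) * (Real.exp (-t) * t ^ (s - 1))) ?_ ?_
    ((Real.GammaIntegral_convergent hs).const_mul _) ?_
  · filter_upwards [hev] with y hy
    exact (integrableOn_rpow_mul_clausenKernel hs (Real.neg_one_le_cos y)
      (hy.trans hd1)).aestronglyMeasurable
  · filter_upwards [hev] with y hy
    filter_upwards [ae_restrict_mem measurableSet_Ioi] with t ht
    have ht0 : 0 ≤ t ^ (s - 1) := Real.rpow_nonneg (mem_Ioi.1 ht).le _
    rw [Real.norm_eq_abs, abs_mul, abs_of_nonneg ht0]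
    calc t ^ (s - 1) * |clausenKernel (Real.cos y) t|
        ≤ t ^ (s - 1) * (4 / (1 - Real.cos y) * Real.exp (-t)) :=
          mul_le_mul_of_nonneg_left
            (norm_clausenKernel_le (Real.neg_one_le_cos y) (hy.trans hd1) ht) ht0
      _ ≤ t ^ (s - 1) * (4 / (1 - d) * Real.exp (-t)) := by gcongr
      _ = _ := by ring
  · filter_upwards [ae_restrict_mem measurableSet_Ioi] with t ht
    have := Real.one_le_cosh t
    have hne : 2 * (Real.cosh t - Real.cos x) ≠ 0 :=
      (by linarith : 0 < 2 * (Real.cosh t - Real.cos x)).ne'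
    unfold clausenKernel
    exact continuousAt_const.mul (ContinuousAt.div (by fun_prop) (by fun_prop) hne)

lemma neg_half_le_clausenKernel {c t : ℝ} (hc1 : c < 1) (ht : 0 ≤ t) :
    -(1 / 2) ≤ clausenKernel c t := by
  have h1 := Real.one_le_cosh t
  rw [clausenKernel, le_div_iff₀ (by linarith)]
  have h2 : Real.cosh t - Real.exp (-t) = Real.sinh t := by
    rw [Real.cosh_eq, Real.sinh_eq]; ring
  linarith [Real.sinh_nonneg_iff.2 ht]

lemma exp_neg_le_inv_one_add {t : ℝ} (ht : 0 ≤ t) : Real.exp (-t) ≤ 1 / (1 + t) := by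
  rw [Real.exp_neg, ← one_div]
  exact one_div_le_one_div_of_le (by linarith) (by linarith [Real.add_one_le_exp t])

lemma clausenKernel_cos_nonneg {y t : ℝ} (hy : y ∈ Ioo (0 : ℝ) (1 / 2)) (ht : 1 / 2 ≤ t) :
    0 ≤ clausenKernel (Real.cos y) t := by
  have h1 := Real.one_le_cosh t
  have h2 := Real.one_sub_sq_div_two_le_cos (x := y)
  have h3 : Real.exp (-t) ≤ 2 / 3 := (exp_neg_le_inv_one_add (by linarith)).trans
    ((div_le_iff₀ (by linarith)).2 (by linarith))
  obtain ⟨hy0, hy1⟩ := hy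
  exact div_nonneg (by nlinarith) (by linarith [Real.cos_le_one y])

lemma inv_le_clausenKernel_cos {y t : ℝ} (hy : y ∈ Ioo (0 : ℝ) (1 / 2)) (hyt : y ≤ t)
    (ht : t ≤ 1 / 2) : 1 / 6 * t⁻¹ ≤ clausenKernel (Real.cos y) t := by
  obtain ⟨hy0, hy1⟩ := hy
  have ht0 : 0 < t := hy0.trans_le hyt
  have h2 := Real.one_sub_sq_div_two_le_cos (x := y)
  have hcos : Real.cos y < 1 :=
    cos_lt_one_of_mem_Ioo ⟨hy0, by linarith [Real.pi_gt_three]⟩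
  have hcosh1 := Real.one_le_cosh t
  have h3 : Real.exp (-t) ≤ 1 - 2 * t / 3 := (exp_neg_le_inv_one_add ht0.le).trans
    ((div_le_iff₀ (by linarith)).2 (by nlinarith))
  have h4 : Real.cosh t ≤ 1 + 4 * t ^ 2 / 7 := by
    have h6 : 1 - t ^ 2 / 2 ≤ Real.exp (-(t ^ 2 / 2)) := by
      linarith [Real.add_one_le_exp (-(t ^ 2 / 2))]
    have h7 : Real.exp (t ^ 2 / 2) * Real.exp (-(t ^ 2 / 2)) = 1 := by
      rw [← Real.exp_add]; simp
    have h8 : Real.exp (t ^ 2 / 2) * (1 - t ^ 2 / 2) ≤ 1 :=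
      (mul_le_mul_of_nonneg_left h6 (Real.exp_pos _).le).trans_eq h7
    have h9 : t ^ 2 ≤ 1 / 4 := by nlinarith
    refine (Real.cosh_le_exp_half_sq t).trans ?_
    have h10 : 1 ≤ (1 + 4 * t ^ 2 / 7) * (1 - t ^ 2 / 2) := by nlinarith [sq_nonneg t]
    exact le_of_mul_le_mul_right (h8.trans h10) (by linarith)
  have hyy : y ^ 2 ≤ t ^ 2 := by gcongr
  rw [clausenKernel, le_div_iff₀ (by linarith), ← one_div, ← mul_div_mul_comm, one_mul,
    div_mul_eq_mul_div, div_le_iff₀ (by positivity)]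
  nlinarith

lemma le_integral_clausenKernel_cos {s y : ℝ} (hs : 0 < s) (hs1 : s < 1)
    (hy : y ∈ Ioo (0 : ℝ) (1 / 2)) :
    -(1 / 2) * (1 / s) + 1 / 6 * ((y ^ (s - 1) - (1 / 2) ^ (s - 1)) / (1 - s)) ≤
      ∫ t in Ioi (0 : ℝ), t ^ (s - 1) * clausenKernel (Real.cos y) t := by
  obtain ⟨hy0, hy1⟩ := hy
  have hcos : Real.cos y < 1 :=
    cos_lt_one_of_mem_Ioo ⟨hy0, by linarith [Real.pi_gt_three]⟩
  have hint := integrableOn_rpow_mul_clausenKernel hs (Real.neg_one_le_cos y) hcos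
  have hint2 : IntegrableOn (fun t : ℝ => t ^ (s - 1) * clausenKernel (Real.cos y) t) (Ioi y) :=
    hint.mono_set (Ioi_subset_Ioi hy0.le)
  rw [← Ioc_union_Ioi_eq_Ioi hy0.le, setIntegral_union (Ioc_disjoint_Ioi le_rfl)
      measurableSet_Ioi (hint.mono_set Ioc_subset_Ioi_self) hint2,
    ← Ioc_union_Ioi_eq_Ioi hy1.le, setIntegral_union (Ioc_disjoint_Ioi le_rfl)
      measurableSet_Ioi (hint2.mono_set Ioc_subset_Ioi_self)
      (hint2.mono_set (Ioi_subset_Ioi hy1.le))]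
  have hA : -(1 / 2) * (1 / s) ≤
      ∫ t in Ioc 0 y, t ^ (s - 1) * clausenKernel (Real.cos y) t := by
    have hval : ∫ t in Ioc 0 y, t ^ (s - 1) * (-(1 / 2)) = -(1 / 2) * (y ^ s / s) := by
      rw [integral_mul_const, ← intervalIntegral.integral_of_le hy0.le,
        integral_rpow (Or.inl (by linarith)), sub_add_cancel, Real.zero_rpow hs.ne']
      ring
    have hys : y ^ s ≤ 1 := Real.rpow_le_one hy0.le (by linarith) hs.le
    calc -(1 / 2) * (1 / s) ≤ -(1 / 2) * (y ^ s / s) := by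
          have : y ^ s / s ≤ 1 / s := by gcongr
          linarith
      _ = ∫ t in Ioc 0 y, t ^ (s - 1) * (-(1 / 2)) := hval.symm
      _ ≤ _ := by
        refine setIntegral_mono_on ?_ (hint.mono_set Ioc_subset_Ioi_self) measurableSet_Ioc
          fun t ht => mul_le_mul_of_nonneg_left (neg_half_le_clausenKernel hcos ht.1.le)
            (Real.rpow_nonneg ht.1.le _)
        exact ((intervalIntegrable_iff_integrableOn_Ioc_of_le hy0.le).1
          (intervalIntegral.intervalIntegrable_rpow' (by linarith))).mul_const _
  have hB : 1 / 6 * ((y ^ (s - 1) - (1 / 2) ^ (s - 1)) / (1 - s)) ≤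
      ∫ t in Ioc y (1 / 2), t ^ (s - 1) * clausenKernel (Real.cos y) t := by
    have h0 : (0 : ℝ) ∉ uIcc y (1 / 2) := by
      rw [uIcc_of_le hy1.le]; exact fun h => absurd h.1 (by linarith)
    have hval : ∫ t in Ioc y (1 / 2), 1 / 6 * t ^ (s - 2) =
        1 / 6 * ((y ^ (s - 1) - (1 / 2) ^ (s - 1)) / (1 - s)) := by
      rw [integral_const_mul, ← intervalIntegral.integral_of_le hy1.le,
        integral_rpow (Or.inr ⟨by linarith, h0⟩), show s - 2 + 1 = s - 1 by ring,
        ← neg_sub s 1, div_neg, ← neg_div, neg_sub]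
    rw [← hval]
    refine setIntegral_mono_on ?_ (hint2.mono_set Ioc_subset_Ioi_self) measurableSet_Ioc
      fun t ht => ?_
    · exact ((intervalIntegrable_iff_integrableOn_Ioc_of_le hy1.le).1
        (intervalIntegral.intervalIntegrable_rpow (Or.inr h0))).const_mul _
    · have ht0 : 0 < t := hy0.trans ht.1
      have : t ^ (s - 2) = t ^ (s - 1) * t⁻¹ := by
        rw [← Real.rpow_neg_one t, ← Real.rpow_add ht0]; congr 1; ring
      rw [this, mul_left_comm]
      exact mul_le_mul_of_nonneg_left (inv_le_clausenKernel_cos ⟨hy0, hy1⟩ ht.1.le ht.2)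
        (Real.rpow_nonneg ht0.le _)
  have hC : 0 ≤ ∫ t in Ioi (1 / 2 : ℝ), t ^ (s - 1) * clausenKernel (Real.cos y) t :=
    setIntegral_nonneg measurableSet_Ioi fun t ht =>
      mul_nonneg (Real.rpow_nonneg (by linarith [mem_Ioi.1 ht]) _)
        (clausenKernel_cos_nonneg ⟨hy0, hy1⟩ (mem_Ioi.1 ht).le)
  linarith

lemma tendsto_Cl_nhdsGT_zero {s : ℝ} (hs : 0 < s) (hs1 : s < 1) :
    Tendsto (Cl s) (𝓝[>] 0) atTop := by
  have hG : 0 < (Real.Gamma s)⁻¹ := inv_pos.2 (Real.Gamma_pos_of_pos hs)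
  have h1 : Tendsto (fun y : ℝ => -(1 / 2) * (1 / s) +
      1 / 6 * ((y ^ (s - 1) - (1 / 2) ^ (s - 1)) / (1 - s))) (𝓝[>] 0) atTop := by
    refine tendsto_atTop_add_const_left _ _ (Tendsto.const_mul_atTop (by norm_num) ?_)
    refine Tendsto.atTop_div_const (by linarith) ?_
    exact tendsto_atTop_add_const_right _ _ (tendsto_rpow_neg_nhdsGT_zero (by linarith))
  refine tendsto_atTop_mono' _ ?_ (h1.const_mul_atTop hG)
  filter_upwards [Ioo_mem_nhdsGT (show (0 : ℝ) < 1 / 2 by norm_num)] with y hy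
  rw [Cl_eq_integral hs ⟨hy.1, by linarith [hy.2, Real.pi_gt_three]⟩]
  exact mul_le_mul_of_nonneg_left (le_integral_clausenKernel_cos hs hs1 hy) hG.le

section Ihat

variable {α x : ℝ}

lemma continuousOn_Ihat (hα : α < 0) (hx : x ∈ Ioo 0 π) :
    ContinuousOn (Ihat α x) (Ioo 0 1) := by
  have hC := continuousOn_Cl (s := -α) (by linarith)
  obtain ⟨hx0, hx1⟩ := hx
  refine ((hC.comp (by fun_prop) fun t ht => ?_).add
    (hC.comp (by fun_prop) fun t ht => ?_)).sub
    (continuousOn_const.mul (hC.comp (by fun_prop) fun t ht => ?_)) <;>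
  · obtain ⟨h0, h1⟩ := ht
    constructor <;> nlinarith

lemma tendsto_Ihat_nhdsGT_zero (hα1 : -1 < α) (hα : α < 0) (hx : x ∈ Ioo 0 π) :
    Tendsto (Ihat α x) (𝓝[>] 0) atBot := by
  have hCx : ContinuousAt (Cl (-α)) x := (continuousOn_Cl (by linarith)).continuousAt
    (Ioo_mem_nhds hx.1 (by linarith [hx.1, hx.2]))
  have h1 : Tendsto (fun t : ℝ => Cl (-α) (x * (1 - t)) + Cl (-α) (x * (1 + t))) (𝓝[>] 0)
      (𝓝 (Cl (-α) x + Cl (-α) x)) := by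
    refine Tendsto.mono_left (Tendsto.add (hCx.tendsto.comp ?_) (hCx.tendsto.comp ?_))
      nhdsWithin_le_nhds
    · exact Continuous.tendsto' (by fun_prop) _ _ (by simp)
    · exact Continuous.tendsto' (by fun_prop) _ _ (by simp)
  have h2 : Tendsto (fun t : ℝ => x * t) (𝓝[>] 0) (𝓝[>] 0) := by
    refine tendsto_nhdsWithin_iff.2 ⟨Tendsto.mono_left
      (Continuous.tendsto' (by fun_prop) _ _ (by simp)) nhdsWithin_le_nhds, ?_⟩
    filter_upwards [self_mem_nhdsWithin] with t ht using mul_pos hx.1 ht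
  have h3 := ((tendsto_Cl_nhdsGT_zero (s := -α) (by linarith) (by linarith)).comp
    h2).const_mul_atTop (zero_lt_two' ℝ)
  exact h1.add_atBot (tendsto_neg_atTop_atBot.comp h3)

lemma tendsto_Ihat_nhdsLT_one (hα1 : -1 < α) (hα : α < 0) (hx : x ∈ Ioo 0 π) :
    Tendsto (Ihat α x) (𝓝[<] 1) atTop := by
  have hC := continuousOn_Cl (s := -α) (by linarith)
  have hCx : ContinuousAt (Cl (-α)) x := hC.continuousAt
    (Ioo_mem_nhds hx.1 (by linarith [hx.1, hx.2]))
  have hC2x : ContinuousAt (Cl (-α)) (x * 2) := hC.continuousAt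
    (Ioo_mem_nhds (by linarith [hx.1]) (by linarith [hx.2]))
  have h1 : Tendsto (fun t : ℝ => Cl (-α) (x * (1 + t)) - 2 * Cl (-α) (x * t)) (𝓝[<] 1)
      (𝓝 (Cl (-α) (x * 2) - 2 * Cl (-α) x)) := by
    refine Tendsto.mono_left (Tendsto.sub (hC2x.tendsto.comp ?_)
      ((hCx.tendsto.comp ?_).const_mul 2)) nhdsWithin_le_nhds
    · exact Continuous.tendsto' (by fun_prop) _ _ (by norm_num)
    · exact Continuous.tendsto' (by fun_prop) _ _ (by simp)
  have h2 : Tendsto (fun t : ℝ => x * (1 - t)) (𝓝[<] 1) (𝓝[>] 0) := by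
    refine tendsto_nhdsWithin_iff.2 ⟨Tendsto.mono_left
      (Continuous.tendsto' (by fun_prop) _ _ (by simp)) nhdsWithin_le_nhds, ?_⟩
    filter_upwards [self_mem_nhdsWithin] with t ht using mul_pos hx.1 (sub_pos.2 ht)
  refine (((tendsto_Cl_nhdsGT_zero (s := -α) (by linarith) (by linarith)).comp
    h2).atTop_add h1).congr fun t => ?_
  simp only [Ihat, Function.comp_apply]
  ring

lemma exists_root_lt_of_Ihat_pos (hα1 : -1 < α) (hα : α < 0) (hx : x ∈ Ioo 0 π) {t : ℝ}
    (ht : t ∈ Ioo (0 : ℝ) 1) (hpos : 0 < Ihat α x t) :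
    ∃ u ∈ Ioo (0 : ℝ) 1, u < t ∧ Ihat α x u = 0 := by
  obtain ⟨v, hv, hv0, hvt⟩ := (((tendsto_Ihat_nhdsGT_zero hα1 hα hx).eventually_lt_atBot 0).and
    (Ioo_mem_nhdsGT ht.1)).exists
  have hcont : ContinuousOn (Ihat α x) (Icc v t) :=
    (continuousOn_Ihat hα hx).mono fun w hw => ⟨hv0.trans_le hw.1, hw.2.trans_lt ht.2⟩
  obtain ⟨u, hu, hu0⟩ := intermediate_value_Ioo hvt.le hcont ⟨hv, hpos⟩
  exact ⟨u, ⟨hv0.trans hu.1, hu.2.trans ht.2⟩, hu.2, hu0⟩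

lemma exists_root_gt_of_Ihat_neg (hα1 : -1 < α) (hα : α < 0) (hx : x ∈ Ioo 0 π) {t : ℝ}
    (ht : t ∈ Ioo (0 : ℝ) 1) (hneg : Ihat α x t < 0) :
    ∃ u ∈ Ioo (0 : ℝ) 1, t < u ∧ Ihat α x u = 0 := by
  obtain ⟨v, hv, htv, hv1⟩ := (((tendsto_Ihat_nhdsLT_one hα1 hα hx).eventually_gt_atTop 0).and
    (Ioo_mem_nhdsLT ht.2)).exists
  have hcont : ContinuousOn (Ihat α x) (Icc t v) :=
    (continuousOn_Ihat hα hx).mono fun w hw => ⟨ht.1.trans_le hw.1, hw.2.trans_lt hv1⟩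
  obtain ⟨u, hu, hu0⟩ := intermediate_value_Ioo htv.le hcont ⟨hneg, hv⟩
  exact ⟨u, ⟨ht.1.trans hu.1, hu.2.trans hv1⟩, hu.1, hu0⟩

lemma strictMonoOn_Icc_of_deriv_pos {f : ℝ → ℝ} {a b : ℝ}
    (hf : ∀ y ∈ Icc a b, 0 < deriv f y) : StrictMonoOn f (Icc a b) :=
  strictMonoOn_of_deriv_pos (convex_Icc a b)
    (fun y hy => (differentiableAt_of_deriv_ne_zero
      (hf y hy).ne').continuousAt.continuousWithinAt)
    fun y hy => hf y (interior_subset hy)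

end Ihat

/-- A posteriori monotonicity check for the root `r_{α,x}` of `t ↦ Î_α(x,t)` over an
interval of values of `α`: positivity of the `α`-derivative of `Î_α(x, ·)` at the root for
an endpoint yields one-sided bounds on the roots. -/
theorem root_alpha_monotonicity_check (a b x : ℝ)
    (ha : -1 < a) (hab : a ≤ b) (hb : b < 0) (hx : x ∈ Set.Ioo (0 : ℝ) π)
    (r : ℝ → ℝ)
    (hroot : ∀ α ∈ Set.Icc a b, r α ∈ Set.Ioo (0 : ℝ) 1 ∧ Ihat α x (r α) = 0 ∧
      ∀ t ∈ Set.Ioo (0 : ℝ) 1, Ihat α x t = 0 → t = r α) :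
    ((∀ α ∈ Set.Icc a b, 0 < deriv (fun β : ℝ => Ihat β x (r a)) α) →
      ∀ α ∈ Set.Icc a b, r α ≤ r a) ∧
    ((∀ α ∈ Set.Icc a b, 0 < deriv (fun β : ℝ => Ihat β x (r b)) α) →
      ∀ α ∈ Set.Icc a b, r b ≤ r α) := by
  refine ⟨fun h α hα => ?_, fun h α hα => ?_⟩
  · rcases hα.1.eq_or_lt with rfl | hlt
    · exact le_rfl
    have hmono := strictMonoOn_Icc_of_deriv_pos h (left_mem_Icc.2 hab) hα hlt
    obtain ⟨hra, hra0, -⟩ := hroot a (left_mem_Icc.2 hab)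
    simp only [hra0] at hmono
    obtain ⟨u, hu, hut, hu0⟩ := exists_root_lt_of_Ihat_pos (by linarith) (hα.2.trans_lt hb) hx
      hra hmono
    exact (hroot α hα).2.2 u hu hu0 ▸ hut.le
  · rcases hα.2.eq_or_lt with rfl | hlt
    · exact le_rfl
    have hmono := strictMonoOn_Icc_of_deriv_pos h hα (right_mem_Icc.2 hab) hlt
    obtain ⟨hrb, hrb0, -⟩ := hroot b (right_mem_Icc.2 hab)
    simp only [hrb0] at hmono
    obtain ⟨u, hu, hut, hu0⟩ := exists_root_gt_of_Ihat_neg (ha.trans_le hα.1)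
      (hα.2.trans_lt hb) hx hrb hmono
    exact (hroot α hα).2.2 u hu hu0 ▸ hut.le
end

section
/- For every α ∈ (−1, 0) and every x ∈ (0, π): I_α(x, y) := C_{−α}(x − y) + C_{−α}(x + y) − 2C_{−α}(y) > 0 for all y ∈ (x, π), and Î_α(x, t) := C_{−α}(x(1 − t)) + C_{−α}(x(1 + t)) − 2C_{−α}(xt) > 0 for all t ∈ (1, π/x). -/
open scoped Real
open Set

open Complex in
/-- Mean value bound for the complex power `x ↦ x ^ (-z)` on a half-line `[m, ∞)`, `m > 0`. -/
lemma norm_ofReal_cpow_neg_sub_le_s11 {m a b : ℝ} (hm : 0 < m) (ha : m ≤ a) (hb : m ≤ b)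
    {z : ℂ} (hz : 0 < z.re) :
    ‖(b : ℂ) ^ (-z) - (a : ℂ) ^ (-z)‖ ≤ ‖z‖ * m ^ (-z.re - 1) * |b - a| := by
  have hz0 : -z ≠ 0 := by
    intro h
    rw [neg_eq_zero.mp h] at hz
    simp at hz
  refine (convex_Ici m).norm_image_sub_le_of_norm_hasDerivWithin_le
    (f := fun x : ℝ ↦ (x : ℂ) ^ (-z)) (f' := fun x : ℝ ↦ -z * (x : ℂ) ^ (-z - 1))
    (fun x hx ↦ (hasDerivAt_ofReal_cpow_const (hm.trans_le hx).ne' hz0).hasDerivWithinAt)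
    (fun x hx ↦ ?_) ha hb
  rw [norm_mul, norm_neg, norm_cpow_eq_rpow_re_of_pos (hm.trans_le hx)]
  gcongr
  simpa using Real.rpow_le_rpow_of_nonpos hm hx (by linarith : -z.re - 1 ≤ 0)

open HurwitzZeta Complex in
/-- The series for a difference of two Hurwitz zeta functions converges to the analytic
continuation on the half-plane `0 < re z`. -/
lemma hasSum_hurwitzZeta_sub_hurwitzZeta {a b : ℝ} (ha : a ∈ Ioo 0 1) (hb : b ∈ Ioo 0 1)
    {z : ℂ} (hz : 0 < z.re) :
    HasSum (fun n : ℕ ↦ ((n + b : ℝ) : ℂ) ^ (-z) - ((n + a : ℝ) : ℂ) ^ (-z))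
      (hurwitzZeta b z - hurwitzZeta a z) := by
  set m := min a b
  have hm0 : 0 < m := lt_min ha.1 hb.1
  have hm1 : m ≤ 1 := (min_le_left _ _).trans ha.2.le
  set R := ‖z‖ + 3
  set ε := z.re / 2 with hε
  have hε0 : 0 < ε := by positivity
  set U : Set ℂ := {w | ε < w.re} ∩ Metric.ball 0 R
  have hUo : IsOpen U := (isOpen_lt continuous_const continuous_re).inter Metric.isOpen_ball
  have hUc : IsPreconnected U :=
    ((convex_halfSpace_re_gt ε).inter (convex_ball 0 R)).isPreconnected
  have hzU : z ∈ U := ⟨by simp only [mem_ofPred_eq]; linarith, by simp [R]⟩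
  set F : ℕ → ℂ → ℂ := fun n w ↦ ((n + b : ℝ) : ℂ) ^ (-w) - ((n + a : ℝ) : ℂ) ^ (-w)
  set u : ℕ → ℝ := fun n ↦ R * m ^ (-R - 1) * ((n + 1 : ℕ) : ℝ) ^ (-ε - 1) with hu_def
  have hu : Summable u :=
    ((summable_nat_add_iff 1).mpr
      (Real.summable_nat_rpow.mpr (by linarith : -ε - 1 < -1))).mul_left _
  have hFu : ∀ n, ∀ w ∈ U, ‖F n w‖ ≤ u n := by
    rintro n w ⟨hw, hwR⟩
    simp only [mem_ofPred_eq] at hw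
    have hwR : ‖w‖ ≤ R := by simpa using (Metric.mem_ball.mp hwR).le
    have hre : w.re ≤ R := (re_le_norm w).trans hwR
    have hn : (0 : ℝ) ≤ n := n.cast_nonneg
    have hmn : m * (n + 1) ≤ n + m := by nlinarith
    have hpos : 0 < m * ((n : ℝ) + 1) := by positivity
    have h := norm_ofReal_cpow_neg_sub_le_s11 (a := n + a) (b := n + b) hpos
      (hmn.trans (by gcongr; exact min_le_left _ _))
      (hmn.trans (by gcongr; exact min_le_right _ _)) (hε0.trans hw)
    have hab : |(n + b) - (n + a)| ≤ 1 := by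
      rw [abs_le]
      constructor <;> linarith [ha.1, ha.2, hb.1, hb.2]
    calc ‖F n w‖ ≤ ‖w‖ * (m * (n + 1)) ^ (-w.re - 1) * |(n + b) - (n + a)| := h
      _ ≤ ‖w‖ * (m * (n + 1)) ^ (-w.re - 1) * 1 := by gcongr
      _ = ‖w‖ * m ^ (-w.re - 1) * ((n + 1 : ℕ) : ℝ) ^ (-w.re - 1) := by
        rw [Real.mul_rpow hm0.le (by positivity)]
        push_cast
        ring
      _ ≤ u n := by
        have h1 : m ^ (-w.re - 1) ≤ m ^ (-R - 1) :=
          Real.rpow_le_rpow_of_exponent_ge hm0 hm1 (by linarith)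
        have h2 : ((n + 1 : ℕ) : ℝ) ^ (-w.re - 1) ≤ ((n + 1 : ℕ) : ℝ) ^ (-ε - 1) :=
          Real.rpow_le_rpow_of_exponent_le (by push_cast; linarith) (by linarith)
        simp only [hu_def]
        gcongr
  have hFd : ∀ n, DifferentiableOn ℂ (F n) U := by
    intro n
    have h (c : ℝ) (hc : 0 < c) : Differentiable ℂ fun w : ℂ ↦ ((n + c : ℝ) : ℂ) ^ (-w) :=
      differentiable_neg.const_cpow (.inl (ofReal_ne_zero.mpr (by positivity)))
    exact ((h b hb.1).sub (h a ha.1)).differentiableOn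
  have hd : DifferentiableOn ℂ (fun w ↦ ∑' n, F n w) U :=
    differentiableOn_tsum_of_summable_norm hu hFd hUo hFu
  have hz2U : z + 2 ∈ U := by
    refine ⟨?_, ?_⟩
    · simp only [mem_ofPred_eq, add_re, re_ofNat]
      linarith
    · have := norm_add_le z 2
      simp only [Metric.mem_ball, dist_zero_right, R]
      norm_num at this
      linarith
  have heq : EqOn (fun w ↦ ∑' n, F n w) (fun w ↦ hurwitzZeta b w - hurwitzZeta a w) U := by
    refine (hd.analyticOnNhd hUo).eqOn_of_preconnected_of_eventuallyEq
      ((differentiable_hurwitzZeta_sub_hurwitzZeta b a).differentiableOn.analyticOnNhd hUo)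
      hUc hz2U ?_
    filter_upwards [(isOpen_lt continuous_const continuous_re).mem_nhds
      (show (1 : ℝ) < (z + 2).re by simp only [add_re, re_ofNat]; linarith)] with w hw
    have hb' := hasSum_hurwitzZeta_of_one_lt_re (Ioo_subset_Icc_self hb) hw
    have ha' := hasSum_hurwitzZeta_of_one_lt_re (Ioo_subset_Icc_self ha) hw
    rw [← (hb'.sub ha').tsum_eq]
    simp [F, cpow_neg]
  have hs : Summable fun n ↦ F n z := .of_norm_bounded hu fun n ↦ hFu n z hzU
  exact hs.hasSum_iff.mpr (heq hzU)

/-- Strict midpoint convexity of `x ↦ x ^ (-w)` on the positive half-line. -/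
lemma two_mul_rpow_neg_lt {a h w : ℝ} (hh : 0 < h) (hha : h < a) (hw : 0 < w) :
    2 * a ^ (-w) < (a + h) ^ (-w) + (a - h) ^ (-w) := by
  have ha : 0 < a := hh.trans hha
  have hP : 0 < (a + h) ^ (-w) := by positivity
  have hQ : 0 < (a - h) ^ (-w) := Real.rpow_pos_of_pos (sub_pos.mpr hha) _
  have hR : 0 < a ^ (-w) := by positivity
  have key : a ^ (-w) * a ^ (-w) < (a + h) ^ (-w) * (a - h) ^ (-w) := by
    rw [← Real.mul_rpow ha.le ha.le, ← Real.mul_rpow (by positivity) (sub_pos.mpr hha).le]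
    exact Real.rpow_lt_rpow_of_neg (mul_pos (by positivity) (sub_pos.mpr hha))
      (by nlinarith) (by linarith)
  nlinarith [sq_nonneg ((a + h) ^ (-w) - (a - h) ^ (-w))]

open HurwitzZeta Complex in
/-- Strict midpoint convexity of `a ↦ ζ(w, a)` on `(0, 1)`, for `w > 0`. -/
lemma two_mul_re_hurwitzZeta_lt {a h w : ℝ} (hh : 0 < h) (hha : h < a) (hah : a + h < 1)
    (hw : 0 < w) :
    2 * (hurwitzZeta (a : UnitAddCircle) w).re <
      (hurwitzZeta ((a + h : ℝ) : UnitAddCircle) w).re +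
        (hurwitzZeta ((a - h : ℝ) : UnitAddCircle) w).re := by
  have ha : a ∈ Ioo 0 1 := ⟨by linarith, by linarith⟩
  have hterm (n : ℕ) (c : ℝ) (hc : 0 < c) :
      (((n + c : ℝ) : ℂ) ^ (-(w : ℂ))).re = (n + c : ℝ) ^ (-w) := by
    rw [← ofReal_neg, ← ofReal_cpow (by positivity), ofReal_re]
  have h1 := hasSum_re (hasSum_hurwitzZeta_sub_hurwitzZeta (z := w) (b := a + h) ha
    ⟨by linarith, hah⟩ (by simpa))
  have h2 := hasSum_re (hasSum_hurwitzZeta_sub_hurwitzZeta (z := w) (b := a - h) ha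
    ⟨by linarith, by linarith⟩ (by simpa))
  have hpos (n : ℕ) :
      0 < (((n + (a + h) : ℝ) : ℂ) ^ (-(w : ℂ)) - ((n + a : ℝ) : ℂ) ^ (-(w : ℂ))).re
      + (((n + (a - h) : ℝ) : ℂ) ^ (-(w : ℂ)) - ((n + a : ℝ) : ℂ) ^ (-(w : ℂ))).re := by
    rw [sub_re, sub_re, hterm n _ (by linarith), hterm n _ ha.1, hterm n _ (by linarith)]
    have := two_mul_rpow_neg_lt (a := n + a) hh (by linarith [n.cast_nonneg (α := ℝ)]) hw
    rw [add_assoc, add_sub_assoc] at this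
    linarith
  have h3 := h1.add h2
  have h4 := h3.summable.tsum_pos (fun n ↦ (hpos n).le) 0 (hpos 0)
  rw [h3.tsum_eq, sub_re, sub_re] at h4
  linarith

open HurwitzZeta Complex in
/-- Strict midpoint convexity of the Clausen function of order `s ∈ (0, 1)` on `(0, 2π)`. -/
lemma two_mul_Cl_lt {s x y : ℝ} (hs : s ∈ Ioo 0 1) (hx : 0 < x) (hxy : x < y)
    (hxy' : y + x < 2 * π) :
    2 * Cl s y < Cl s (y + x) + Cl s (y - x) := by
  set w := 1 - s with hw
  have hw0 : 0 < w := by linarith [hs.2]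
  have hw1 : w < 1 := by linarith [hs.1]
  set K : ℝ := 2 * (2 * π) ^ (-w) * Real.Gamma w * Real.cos (π * w / 2) with hK
  have hcos : 0 < Real.cos (π * w / 2) :=
    Real.cos_pos_of_mem_Ioo ⟨by nlinarith [Real.pi_pos], by nlinarith [Real.pi_pos]⟩
  have hKpos : 0 < K := by
    have := Real.Gamma_pos_of_pos hw0
    positivity
  have hne (n : ℕ) : (w : ℂ) ≠ 1 - n := by
    intro h
    have h' : w = 1 - n := by exact_mod_cast h
    rcases n with _ | n
    · simp at h'
      linarith
    · push_cast at h'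
      linarith [n.cast_nonneg (α := ℝ)]
  have hCl (v : ℝ) : Cl s v = K / 2 * ((hurwitzZeta ((v / (2 * π) : ℝ) : UnitAddCircle) w).re +
      (hurwitzZeta ((1 - v / (2 * π) : ℝ) : UnitAddCircle) w).re) := by
    have hneg : ((1 - v / (2 * π) : ℝ) : UnitAddCircle) =
        -((v / (2 * π) : ℝ) : UnitAddCircle) := by
      rw [AddCircle.coe_sub, AddCircle.coe_period, zero_sub]
    have hsw : (s : ℂ) = 1 - (w : ℂ) := by simp [hw]
    have hKc : 2 * (2 * (π : ℂ)) ^ (-(w : ℂ)) * Gamma w * cos (π * w / 2) = (K : ℂ) := by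
      rw [hK, Complex.Gamma_ofReal]
      push_cast [ofReal_cpow (by positivity : 0 ≤ 2 * π)]
      rfl
    rw [Cl, hsw, cosZeta_one_sub _ hne, hKc, re_ofReal_mul, hurwitzZetaEven_eq, hneg,
      ← add_re, div_ofNat_re]
    ring
  have hpi : 0 < 2 * π := by positivity
  have h0 : 0 < x / (2 * π) := by positivity
  have h1 : x / (2 * π) < y / (2 * π) := by gcongr
  have h2 : y / (2 * π) + x / (2 * π) < 1 := by rwa [← add_div, div_lt_one hpi]
  have hA := two_mul_re_hurwitzZeta_lt h0 h1 h2 hw0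
  have hB := two_mul_re_hurwitzZeta_lt (a := 1 - y / (2 * π)) h0 (by linarith) (by linarith) hw0
  rw [hCl, hCl, hCl, add_div, sub_div, sub_add_eq_sub_sub, sub_sub_eq_add_sub,
    add_sub_right_comm]
  nlinarith

/-- The Clausen function is even. -/
lemma Cl_neg (s x : ℝ) : Cl s (-x) = Cl s x := by
  rw [Cl, neg_div, AddCircle.coe_neg, HurwitzZeta.cosZeta_neg, Cl]

/-- Positivity of `I_α(x,y)` for `y ∈ (x,π)` and of `Î_α(x,t)` for `t ∈ (1, π/x)`. -/
theorem I_pos_on_right (α x : ℝ) (hα : α ∈ Set.Ioo (-1 : ℝ) 0)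
    (hx : x ∈ Set.Ioo (0 : ℝ) π) :
    (∀ y ∈ Set.Ioo x π,
      0 < Cl (-α) (x - y) + Cl (-α) (x + y) - 2 * Cl (-α) y) ∧
    (∀ t ∈ Set.Ioo (1 : ℝ) (π / x),
      0 < Cl (-α) (x * (1 - t)) + Cl (-α) (x * (1 + t)) - 2 * Cl (-α) (x * t)) := by
  have hmain : ∀ y ∈ Set.Ioo x π,
      0 < Cl (-α) (x - y) + Cl (-α) (x + y) - 2 * Cl (-α) y := by
    intro y hy
    have h := two_mul_Cl_lt (s := -α) ⟨by linarith [hα.2], by linarith [hα.1]⟩ hx.1 hy.1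
      (by linarith [hx.2, hy.2])
    rw [← neg_sub y x, Cl_neg, add_comm x y]
    linarith
  refine ⟨hmain, fun t ht ↦ ?_⟩
  rw [mul_sub, mul_add, mul_one]
  refine hmain (x * t) ⟨by nlinarith [hx.1, ht.1], ?_⟩
  rw [mul_comm]
  exact (lt_div_iff₀ hx.1).mp ht.2
end
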